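/- For any complete calculus Ω•(A) on a quantum principal bundle B = A^{coH} ⊆ A, the Atiyah sequence 0 → hor¹ → Ω¹(A) →^{π_v} ver¹ → 0 is exact in the category of right H-covariant A-bimodules: the inclusion hor¹ ↪ Ω¹(A) is injective, π_v restricted to Ω¹(A) is surjective onto ver¹ = A⊗Λ¹, and ker(π_v|_{Ω¹(A)}) = hor¹. -/

import Mathlib

open TensorProduct

noncomputable section

namespace NCG

variable {k : Type*} [CommRing k]

/-! ## Coactions -/

section Coactions

variable {H : Type*} [AddCommMonoid H] [Module k H] [Coalgebra k H]
variable {M : Type*} [AddCommMonoid M] [Module k M]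

/-- `ρ : M → M ⊗ H` is a (counital, coassociative) right `H`-coaction. -/
def IsRightCoaction (ρ : M →ₗ[k] M ⊗[k] H) : Prop :=
  (LinearMap.lTensor M (Coalgebra.counit (R := k) (A := H)) ∘ₗ ρ
      = (TensorProduct.mk k M k).flip 1) ∧
  ((TensorProduct.assoc k M H H).toLinearMap ∘ₗ LinearMap.rTensor H ρ ∘ₗ ρ
      = LinearMap.lTensor M (Coalgebra.comul (R := k) (A := H)) ∘ₗ ρ)

/-- `lam : M → H ⊗ M` is a left `H`-coaction. -/
def IsLeftCoaction (lam : M →ₗ[k] H ⊗[k] M) : Prop :=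
  (LinearMap.rTensor M (Coalgebra.counit (R := k) (A := H)) ∘ₗ lam
      = TensorProduct.mk k k M 1) ∧
  ((TensorProduct.assoc k H H M).symm.toLinearMap ∘ₗ LinearMap.lTensor H lam ∘ₗ lam
      = LinearMap.rTensor M (Coalgebra.comul (R := k) (A := H)) ∘ₗ lam)

end Coactions

/-! ## Comodule algebras, coinvariants, Hopf–Galois extensions -/

section ComodAlg

variable (k) in
/-- A right `H`-comodule algebra structure on `A`: an algebra morphism
`ρ : A → A ⊗ H` which is a right `H`-coaction. -/
structure ComodAlg (H : Type*) [Ring H] [Bialgebra k H]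
    (A : Type*) [Ring A] [Algebra k A] where
  ρ : A →ₐ[k] A ⊗[k] H
  coaction : IsRightCoaction (k := k) ρ.toLinearMap

variable {H : Type*} [Ring H] [Bialgebra k H]
variable {A : Type*} [Ring A] [Algebra k A]

/-- The coinvariant subalgebra `B = A^{co H}` (as a submodule). -/
def ComodAlg.coinv (S : ComodAlg k H A) : Submodule k A where
  carrier := {a | S.ρ a = a ⊗ₜ[k] (1 : H)}
  add_mem' := by
    intro a b ha hb
    simp only [Set.mem_setOf_eq] at *
    rw [map_add, ha, hb, TensorProduct.add_tmul]
  zero_mem' := by simp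
  smul_mem' := by
    intro c a ha
    simp only [Set.mem_setOf_eq] at *
    rw [map_smul, ha, TensorProduct.smul_tmul']

lemma ComodAlg.one_mem_coinv (S : ComodAlg k H A) : (1 : A) ∈ S.coinv := by
  show S.ρ 1 = _
  rw [map_one, Algebra.TensorProduct.one_def]

/-- The lift `χ' : A ⊗ A → A ⊗ H`, `a ⊗ a' ↦ (a ⊗ 1) · ρ(a') = a a'₍₀₎ ⊗ a'₍₁₎`
of the canonical Hopf–Galois map. -/
def chiAux (S : ComodAlg k H A) : A ⊗[k] A →ₗ[k] A ⊗[k] H :=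
  TensorProduct.lift
    ((LinearMap.mul k (A ⊗[k] H) ∘ₗ (TensorProduct.mk k A H).flip 1).compl₂ S.ρ.toLinearMap)

/-- The relations defining the balanced tensor product `A ⊗_B A` over a
subalgebra (submodule) `B ⊆ A`. -/
def balRel (B : Submodule k A) : Submodule k (A ⊗[k] A) :=
  Submodule.span k
    {x | ∃ (a a' : A) (b : B), x = (a * (b : A)) ⊗ₜ[k] a' - a ⊗ₜ[k] ((b : A) * a')}

/-- The balanced tensor product `A ⊗_B A`. -/
abbrev TensorOver (B : Submodule k A) : Type _ := (A ⊗[k] A) ⧸ balRel B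

/-- `B = A^{co H} ⊆ A` is a Hopf–Galois extension:  the canonical map
`χ : A ⊗_B A → A ⊗ H` is bijective, i.e. its lift `χ'` is surjective with
kernel exactly the balanced relations. -/
def ComodAlg.IsHopfGalois (S : ComodAlg k H A) : Prop :=
  Function.Surjective (chiAux S) ∧ LinearMap.ker (chiAux S) = balRel S.coinv

/-- The canonical Hopf–Galois map `χ : A ⊗_B A → A ⊗ H` on the balanced
tensor product. -/
def chiQ (S : ComodAlg k H A) (h : balRel S.coinv ≤ LinearMap.ker (chiAux S)) :
    TensorOver S.coinv →ₗ[k] A ⊗[k] H :=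
  Submodule.liftQ _ (chiAux S) h

end ComodAlg

section HopfGalois

variable {H : Type*} [Ring H] [HopfAlgebra k H]
variable {A : Type*} [Ring A] [Algebra k A]

/-- A strong connection (in the sense of Theorem 3.7): a linear map
`ℓ : H → A ⊗ A` satisfying the four identities characterising faithfully
flat Hopf–Galois extensions (principal comodule algebras). -/
def IsStrongConnection (S : ComodAlg k H A) (ℓ : H →ₗ[k] A ⊗[k] A) : Prop :=
  ℓ 1 = 1 ⊗ₜ[k] 1 ∧
  chiAux S ∘ₗ ℓ = TensorProduct.mk k A H 1 ∧
  LinearMap.mul' k A ∘ₗ ℓ =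
    Algebra.linearMap k A ∘ₗ Coalgebra.counit (R := k) (A := H) ∧
  LinearMap.lTensor A S.ρ.toLinearMap ∘ₗ ℓ =
    (TensorProduct.assoc k A A H).toLinearMap ∘ₗ LinearMap.rTensor H ℓ ∘ₗ
      Coalgebra.comul (R := k) (A := H) ∧
  LinearMap.rTensor A S.ρ.toLinearMap ∘ₗ ℓ =
    LinearMap.rTensor A (TensorProduct.comm k H A).toLinearMap ∘ₗ
      (TensorProduct.assoc k H A A).symm.toLinearMap ∘ₗ
      TensorProduct.map (HopfAlgebra.antipode (R := k)) ℓ ∘ₗ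
      Coalgebra.comul (R := k) (A := H)

/-- A quantum principal bundle: a faithfully flat Hopf–Galois extension
`B = A^{co H} ⊆ A`, encoded (following Theorem 3.7 = Th. 6.19/6.20 of
Brzeziński–Wisbauer/Hajac et al.) as a Hopf–Galois extension admitting a
strong connection. -/
def ComodAlg.IsQPB (S : ComodAlg k H A) : Prop :=
  S.IsHopfGalois ∧ ∃ ℓ : H →ₗ[k] A ⊗[k] A, IsStrongConnection S ℓ

end HopfGalois

/-! ## Differential graded algebras and differential calculi -/

section DGA

variable (k) in
/-- A differential graded algebra: an `ℕ`-graded algebra `Ω` together with a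
degree `1` differential squaring to zero and satisfying the graded Leibniz
rule. -/
structure DGA (Ω : Type*) [Ring Ω] [Algebra k Ω] where
  grading : ℕ → Submodule k Ω
  gradedAlgebra : GradedAlgebra grading
  d : Ω →ₗ[k] Ω
  d_mem : ∀ n, ∀ x ∈ grading n, d x ∈ grading (n + 1)
  d_d : ∀ x, d (d x) = 0
  leibniz : ∀ n, ∀ ω ∈ grading n, ∀ η,
    d (ω * η) = d ω * η + ((-1 : k) ^ n) • (ω * d η)

variable {Ω : Type*} [Ring Ω] [Algebra k Ω]

/-- Projection onto the degree `n` component of a graded algebra. -/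
def DGA.projN (C : DGA k Ω) (n : ℕ) : Ω →ₗ[k] Ω :=
  letI := C.gradedAlgebra
  (C.grading n).subtype ∘ₗ DirectSum.component k ℕ (fun i => ↥(C.grading i)) n ∘ₗ
    (DirectSum.decomposeLinearEquiv C.grading).toLinearMap

/-- The sign operator `ς` of a graded algebra, acting by `(-1)^n` in degree `n`. -/
def DGA.sign (C : DGA k Ω) : Ω →ₗ[k] Ω :=
  letI := C.gradedAlgebra
  (DirectSum.toModule k ℕ Ω fun n => ((-1 : k) ^ n) • (C.grading n).subtype) ∘ₗ
    (DirectSum.decomposeLinearEquiv C.grading).toLinearMap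

variable {Ξ : Type*} [Ring Ξ] [Algebra k Ξ]
variable {M : Type*} [AddCommGroup M] [Module k M]

/-- The graded (Koszul) braiding `Ξ ⊗ M → M ⊗ Ξ`, `θ ⊗ m ↦ (-1)^{|θ||m|} m ⊗ θ`,
where the sign on `M` is implemented by the sign operator `s`. -/
def gradedBraid (CN : DGA k Ξ) (s : M →ₗ[k] M) : Ξ ⊗[k] M →ₗ[k] M ⊗[k] Ξ :=
  letI := CN.gradedAlgebra
  TensorProduct.lift
    ((DirectSum.toModule k ℕ (M →ₗ[k] M ⊗[k] Ξ) fun j =>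
        (LinearMap.llcomp k M M (M ⊗[k] Ξ)).flip (s ^ j) ∘ₗ
          (TensorProduct.mk k M Ξ).flip ∘ₗ (CN.grading j).subtype) ∘ₗ
      (DirectSum.decomposeLinearEquiv CN.grading).toLinearMap)

/-- The multiplication of the graded (Koszul-signed) tensor product
`(m ⊗ θ)(m' ⊗ θ') = (-1)^{|θ||m'|} m m' ⊗ θ θ'`, for a (possibly non-unital
carrier) `M` with multiplication `mulM` and sign operator `sM`, and a graded
algebra `Ξ`. -/
def koszulMulGen (mulM : M ⊗[k] M →ₗ[k] M) (mulN : Ξ ⊗[k] Ξ →ₗ[k] Ξ)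
    (CN : DGA k Ξ) (sM : M →ₗ[k] M) :
    (M ⊗[k] Ξ) ⊗[k] (M ⊗[k] Ξ) →ₗ[k] M ⊗[k] Ξ :=
  TensorProduct.map mulM mulN ∘ₗ
    (TensorProduct.assoc k (M ⊗[k] M) Ξ Ξ).toLinearMap ∘ₗ
    LinearMap.rTensor Ξ
      ((TensorProduct.assoc k M M Ξ).symm.toLinearMap ∘ₗ
        LinearMap.lTensor M (gradedBraid CN sM) ∘ₗ
        (TensorProduct.assoc k M Ξ M).toLinearMap) ∘ₗ
    (TensorProduct.assoc k (M ⊗[k] Ξ) M Ξ).symm.toLinearMap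

/-- The Koszul multiplication on the tensor product of two graded algebras. -/
def koszulMul (CM : DGA k Ω) (CN : DGA k Ξ) :
    (Ω ⊗[k] Ξ) ⊗[k] (Ω ⊗[k] Ξ) →ₗ[k] Ω ⊗[k] Ξ :=
  koszulMulGen (LinearMap.mul' k Ω) (LinearMap.mul' k Ξ) CN CM.sign

/-- The tensor product differential `d_⊗ = d ⊗ 1 + ς ⊗ d'`. -/
def dTensorGen (dM : M →ₗ[k] M) (sM : M →ₗ[k] M) {N : Type*} [AddCommGroup N]
    [Module k N] (dN : N →ₗ[k] N) : M ⊗[k] N →ₗ[k] M ⊗[k] N :=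
  TensorProduct.map dM LinearMap.id + TensorProduct.map sM dN

/-- The grading of the tensor product of two graded modules. -/
def tensorGrading {N : Type*} [AddCommGroup N] [Module k N]
    (𝒜 : ℕ → Submodule k M) (ℬ : ℕ → Submodule k N) (n : ℕ) :
    Submodule k (M ⊗[k] N) :=
  ⨆ p : {p : ℕ × ℕ // p.1 + p.2 = n},
    LinearMap.range (TensorProduct.map (𝒜 p.1.1).subtype (ℬ p.1.2).subtype)

end DGA

section DiffCalc

variable (k) in
/-- A differential calculus on an algebra `A`: a differential graded algebra
`Ω` with degree-zero part `A` (embedded via `ι`), generated in degree zero. -/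
structure DiffCalc (A : Type*) [Ring A] [Algebra k A]
    (Ω : Type*) [Ring Ω] [Algebra k Ω] extends DGA k Ω where
  ι : A →ₐ[k] Ω
  ι_injective : Function.Injective ι
  range_ι : ∀ x, x ∈ grading 0 ↔ x ∈ Set.range ι
  generated : Algebra.adjoin k (Set.range ι ∪ ⇑d '' Set.range ι) = ⊤

variable {A : Type*} [Ring A] [Algebra k A]
variable {Ω : Type*} [Ring Ω] [Algebra k Ω]

lemma DiffCalc.ι_mem (C : DiffCalc k A Ω) (a : A) : C.ι a ∈ C.grading 0 :=
  (C.range_ι _).2 ⟨a, rfl⟩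

lemma DiffCalc.d_ι_mem (C : DiffCalc k A Ω) (a : A) : C.d (C.ι a) ∈ C.grading 1 := by
  simpa using C.d_mem 0 (C.ι a) (C.ι_mem a)

lemma DiffCalc.sandwich_mem (C : DiffCalc k A Ω) (a b : A) {x : Ω}
    (hx : x ∈ C.grading 1) : C.ι a * x * C.ι b ∈ C.grading 1 := by
  letI := C.gradedAlgebra
  have h1 : C.ι a * x ∈ C.grading (0 + 1) := SetLike.mul_mem_graded (C.ι_mem a) hx
  have h2 : C.ι a * x * C.ι b ∈ C.grading (0 + 1 + 0) :=
    SetLike.mul_mem_graded h1 (C.ι_mem b)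
  simpa using h2

/-- The degree-zero identification `A ≃ Ω⁰`. -/
def DiffCalc.iota0 (C : DiffCalc k A Ω) : A ≃ₗ[k] ↥(C.grading 0) :=
  LinearEquiv.ofBijective (LinearMap.codRestrict (C.grading 0) C.ι.toLinearMap C.ι_mem)
    ⟨fun a b hab => C.ι_injective (congrArg Subtype.val hab),
     fun y => by
      obtain ⟨a, ha⟩ := (C.range_ι ↑y).1 y.2
      exact ⟨a, Subtype.ext ha⟩⟩

/-- Projection `Ω → A` onto the degree-zero component. -/
def DiffCalc.proj0 (C : DiffCalc k A Ω) : Ω →ₗ[k] A :=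
  letI := C.gradedAlgebra
  C.iota0.symm.toLinearMap ∘ₗ DirectSum.component k ℕ (fun i => ↥(C.grading i)) 0 ∘ₗ
    (DirectSum.decomposeLinearEquiv C.grading).toLinearMap

end DiffCalc

/-! ## Covariant calculi -/

section Covariant

variable {H : Type*} [Ring H] [Bialgebra k H]
variable {A : Type*} [Ring A] [Algebra k A]
variable {Ω : Type*} [Ring Ω] [Algebra k Ω]

/-- The comultiplication of a bialgebra, as a comodule-algebra structure of
`H` over itself. -/
def comulComod (k : Type*) [CommRing k] (H : Type*) [Ring H] [Bialgebra k H] :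
    ComodAlg k H H where
  ρ := Bialgebra.comulAlgHom k H
  coaction := by
    constructor
    · exact Coalgebra.lTensor_counit_comp_comul
    · exact Coalgebra.coassoc

/-- A right `H`-covariant differential calculus on a comodule algebra `A`:
the coaction `ΔR` extends `ρ` multiplicatively, degree-wise, and commutes
with the differential. -/
def IsRightCovariant (S : ComodAlg k H A) (C : DiffCalc k A Ω)
    (ΔR : Ω →ₗ[k] Ω ⊗[k] H) : Prop :=
  IsRightCoaction (k := k) ΔR ∧
  ΔR 1 = 1 ∧ (∀ x y, ΔR (x * y) = ΔR x * ΔR y) ∧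
  (∀ n, ∀ x ∈ C.grading n,
    ΔR x ∈ LinearMap.range (LinearMap.rTensor H (C.grading n).subtype)) ∧
  ΔR ∘ₗ C.d = LinearMap.rTensor H C.d ∘ₗ ΔR ∧
  ΔR ∘ₗ C.ι.toLinearMap = LinearMap.rTensor H C.ι.toLinearMap ∘ₗ S.ρ.toLinearMap

/-- A left-covariant differential calculus on the Hopf algebra `H` itself:
the left coaction `ΛL` extends the comultiplication. -/
def IsLeftCovariantH (C : DiffCalc k H Ω) (ΛL : Ω →ₗ[k] H ⊗[k] Ω) : Prop :=
  IsLeftCoaction (k := k) ΛL ∧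
  ΛL 1 = 1 ∧ (∀ x y, ΛL (x * y) = ΛL x * ΛL y) ∧
  (∀ n, ∀ x ∈ C.grading n,
    ΛL x ∈ LinearMap.range (LinearMap.lTensor H (C.grading n).subtype)) ∧
  ΛL ∘ₗ C.d = LinearMap.lTensor H C.d ∘ₗ ΛL ∧
  ΛL ∘ₗ C.ι.toLinearMap =
    LinearMap.lTensor H C.ι.toLinearMap ∘ₗ Coalgebra.comul (R := k) (A := H)

/-- A bicovariant differential calculus on `H`: commuting right and left
covariant structures both extending the comultiplication. -/
def IsBicovariantH (C : DiffCalc k H Ω) (ΔR : Ω →ₗ[k] Ω ⊗[k] H)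
    (ΛL : Ω →ₗ[k] H ⊗[k] Ω) : Prop :=
  IsRightCovariant (comulComod k H) C ΔR ∧ IsLeftCovariantH C ΛL ∧
  LinearMap.rTensor H ΛL ∘ₗ ΔR =
    (TensorProduct.assoc k H Ω H).symm.toLinearMap ∘ₗ LinearMap.lTensor H ΔR ∘ₗ ΛL

/-- Left-coinvariant elements of a left comodule. -/
def leftCoinv {M : Type*} [AddCommGroup M] [Module k M]
    (lam : M →ₗ[k] H ⊗[k] M) : Submodule k M where
  carrier := {m | lam m = 1 ⊗ₜ[k] m}
  add_mem' := by
    intro a b ha hb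
    simp only [Set.mem_setOf_eq] at *
    rw [map_add, ha, hb, TensorProduct.tmul_add]
  zero_mem' := by simp
  smul_mem' := by
    intro c m hm
    simp only [Set.mem_setOf_eq] at *
    rw [map_smul, hm, TensorProduct.tmul_smul]

end Covariant

/-! ## Maximal prolongations -/

section MaxProl

universe u

variable {A : Type*} [Ring A] [Algebra k A]
variable {Ω : Type*} [Ring Ω] [Algebra k Ω]

/-- `g` identifies the first-order parts of the differential calculi `C` and
`C'` (as first order differential calculi over `A`). -/
def Matches1 {Ω' : Type*} [Ring Ω'] [Algebra k Ω'] (C : DiffCalc k A Ω)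
    (C' : DiffCalc k A Ω') (g : ↥(C.grading 1) →ₗ[k] Ω') : Prop :=
  (∀ x : C.grading 1, g x ∈ C'.grading 1) ∧
  Function.Injective g ∧
  (∀ y ∈ C'.grading 1, ∃ x, g x = y) ∧
  (∀ a : A, g ⟨C.d (C.ι a), C.d_ι_mem a⟩ = C'.d (C'.ι a)) ∧
  (∀ (a b : A) (x : C.grading 1),
    g ⟨C.ι a * ↑x * C.ι b, C.sandwich_mem a b x.2⟩ = C'.ι a * g x * C'.ι b)

/-- `C` is the maximal prolongation of its own first-order part: any other
differential calculus on `A` with the same first order is a quotient of `C`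
(universal property of the maximal prolongation). -/
def IsMaxProl (C : DiffCalc k A Ω) : Prop :=
  ∀ (Ω' : Type u) [Ring Ω'] [Algebra k Ω'], ∀ (C' : DiffCalc k A Ω')
    (g : ↥(C.grading 1) →ₗ[k] Ω'), Matches1 C C' g →
    ∃ Φ : Ω →ₐ[k] Ω',
      (∀ n, ∀ x ∈ C.grading n, Φ x ∈ C'.grading n) ∧
      (∀ x, Φ (C.d x) = C'.d (Φ x)) ∧
      (∀ a, Φ (C.ι a) = C'.ι a) ∧
      (∀ x : C.grading 1, Φ ↑x = g x)

end MaxProl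

/-! ## Complete calculi -/

section Complete

variable {H : Type*} [Ring H] [HopfAlgebra k H]
variable {A : Type*} [Ring A] [Algebra k A]
variable {ΩA : Type*} [Ring ΩA] [Algebra k ΩA]
variable {ΩH : Type*} [Ring ΩH] [Algebra k ΩH]

/-- `D` is an extension of the coaction `ρ : A → A ⊗ H` to a morphism of
differential graded algebras `Ω(A) → Ω(A) ⊗ Ω(H)` (Koszul signs built into
the target); i.e. the calculus `Ω(A)` is *complete* with extension `D`. -/
def IsCompleteExt (S : ComodAlg k H A) (CA : DiffCalc k A ΩA)
    (CH : DiffCalc k H ΩH) (D : ΩA →ₗ[k] ΩA ⊗[k] ΩH) : Prop :=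
  D 1 = 1 ⊗ₜ[k] 1 ∧
  (∀ x y, D (x * y) = koszulMul CA.toDGA CH.toDGA (D x ⊗ₜ[k] D y)) ∧
  D ∘ₗ CA.ι.toLinearMap =
    TensorProduct.map CA.ι.toLinearMap CH.ι.toLinearMap ∘ₗ S.ρ.toLinearMap ∧
  D ∘ₗ CA.d = dTensorGen CA.d CA.toDGA.sign CH.d ∘ₗ D ∧
  (∀ n, ∀ x ∈ CA.grading n, D x ∈ tensorGrading CA.grading CH.grading n)

/-- A complete calculus on the Hopf algebra `H` itself: the comultiplication
extends to a morphism of differential graded algebras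
`Ω(H) → Ω(H) ⊗ Ω(H)`. -/
def IsCompleteExtH (CH : DiffCalc k H ΩH) (D : ΩH →ₗ[k] ΩH ⊗[k] ΩH) : Prop :=
  IsCompleteExt (comulComod k H) CH CH D

/-- The graded counit `ε•` of a complete calculus on `H`: the counit in degree
zero and zero in positive degrees. -/
def epsBul (CH : DiffCalc k H ΩH) : ΩH →ₗ[k] k :=
  Coalgebra.counit (R := k) (A := H) ∘ₗ CH.proj0

end Complete

end NCG
namespace NCG

variable {k : Type*} [CommRing k]

/-! ## First order differential calculi -/

section FODC

variable (k) in
/-- A first order differential calculus `(Γ, d)` on `A`: an `A`-bimodule `Γ`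
(with explicit structure maps) together with a derivation `d : A → Γ`
generating `Γ`. -/
structure FODC (A : Type*) [Ring A] [Algebra k A]
    (Γ : Type*) [AddCommGroup Γ] [Module k Γ] where
  lsmul : A →ₗ[k] Γ →ₗ[k] Γ
  rsmul : A →ₗ[k] Γ →ₗ[k] Γ
  one_lsmul : ∀ x, lsmul 1 x = x
  one_rsmul : ∀ x, rsmul 1 x = x
  mul_lsmul : ∀ a b x, lsmul (a * b) x = lsmul a (lsmul b x)
  mul_rsmul : ∀ a b x, rsmul (a * b) x = rsmul b (rsmul a x)
  lsmul_rsmul : ∀ a b x, lsmul a (rsmul b x) = rsmul b (lsmul a x)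
  d : A →ₗ[k] Γ
  leibniz : ∀ a b, d (a * b) = lsmul a (d b) + rsmul b (d a)
  surj : Submodule.span k {x | ∃ a b, x = lsmul a (d b)} = ⊤

end FODC

/-! ## Diagonal actions on tensor products -/

section ActionHelpers

variable {A H Γ : Type*} [Ring A] [Algebra k A] [Ring H] [Algebra k H]
variable [AddCommGroup Γ] [Module k Γ]

/-- Left action of `A ⊗ H` on `Γ ⊗ H`: `(a ⊗ h) ⊳ (x ⊗ g) = (a ⊳ x) ⊗ h g`. -/
def lactTH (act : A →ₗ[k] Γ →ₗ[k] Γ) :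
    (A ⊗[k] H) →ₗ[k] (Γ ⊗[k] H) →ₗ[k] Γ ⊗[k] H :=
  TensorProduct.curry
    (TensorProduct.map (TensorProduct.lift act) (LinearMap.mul' k H) ∘ₗ
      (TensorProduct.tensorTensorTensorComm k A H Γ H).toLinearMap)

/-- Right action of `A ⊗ H` on `Γ ⊗ H`: `(x ⊗ g) ⊲ (a ⊗ h) = (x ⊲ a) ⊗ g h`. -/
def ractTH (act : A →ₗ[k] Γ →ₗ[k] Γ) :
    (A ⊗[k] H) →ₗ[k] (Γ ⊗[k] H) →ₗ[k] Γ ⊗[k] H :=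
  TensorProduct.curry
    (TensorProduct.map (TensorProduct.lift act)
        (LinearMap.mul' k H ∘ₗ (TensorProduct.comm k H H).toLinearMap) ∘ₗ
      (TensorProduct.tensorTensorTensorComm k A H Γ H).toLinearMap)

/-- Left action of `A ⊗ H` on `A ⊗ Γ`: `(a ⊗ h) ⊳ (c ⊗ x) = a c ⊗ (h ⊳ x)`. -/
def lactHT (act : H →ₗ[k] Γ →ₗ[k] Γ) :
    (A ⊗[k] H) →ₗ[k] (A ⊗[k] Γ) →ₗ[k] A ⊗[k] Γ :=
  TensorProduct.curry
    (TensorProduct.map (LinearMap.mul' k A) (TensorProduct.lift act) ∘ₗ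
      (TensorProduct.tensorTensorTensorComm k A H A Γ).toLinearMap)

/-- Right action of `A ⊗ H` on `A ⊗ Γ`: `(c ⊗ x) ⊲ (a ⊗ h) = c a ⊗ (x ⊲ h)`. -/
def ractHT (act : H →ₗ[k] Γ →ₗ[k] Γ) :
    (A ⊗[k] H) →ₗ[k] (A ⊗[k] Γ) →ₗ[k] A ⊗[k] Γ :=
  TensorProduct.curry
    (TensorProduct.map (LinearMap.mul' k A ∘ₗ (TensorProduct.comm k A A).toLinearMap)
        (TensorProduct.lift act) ∘ₗ
      (TensorProduct.tensorTensorTensorComm k A H A Γ).toLinearMap)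

end ActionHelpers

/-! ## Covariant first order calculi and first order extensions -/

section FODCCov

variable {H : Type*} [Ring H] [Bialgebra k H]
variable {A : Type*} [Ring A] [Algebra k A]
variable {Γ : Type*} [AddCommGroup Γ] [Module k Γ]
variable {ΓH : Type*} [AddCommGroup ΓH] [Module k ΓH]

/-- Right `H`-covariance of a FODC `(Γ, d)` on a comodule algebra `A`. -/
def FODC.IsRightCovariant (S : ComodAlg k H A) (C : FODC k A Γ)
    (ΔΓ : Γ →ₗ[k] Γ ⊗[k] H) : Prop :=
  IsRightCoaction (k := k) ΔΓ ∧
  (∀ a x, ΔΓ (C.lsmul a x) = lactTH C.lsmul (S.ρ a) (ΔΓ x)) ∧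
  (∀ a x, ΔΓ (C.rsmul a x) = ractTH C.rsmul (S.ρ a) (ΔΓ x)) ∧
  ΔΓ ∘ₗ C.d = LinearMap.rTensor H C.d ∘ₗ S.ρ.toLinearMap

/-- Left covariance of a FODC `(Γ, d)` on the Hopf algebra `H` itself. -/
def FODC.IsLeftCovariantH (C : FODC k H Γ) (ΛΓ : Γ →ₗ[k] H ⊗[k] Γ) : Prop :=
  IsLeftCoaction (k := k) ΛΓ ∧
  (∀ h x, ΛΓ (C.lsmul h x) =
    lactHT C.lsmul (Coalgebra.comul (R := k) (A := H) h) (ΛΓ x)) ∧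
  (∀ h x, ΛΓ (C.rsmul h x) =
    ractHT C.rsmul (Coalgebra.comul (R := k) (A := H) h) (ΛΓ x)) ∧
  ΛΓ ∘ₗ C.d = LinearMap.lTensor H C.d ∘ₗ Coalgebra.comul (R := k) (A := H)

/-- Bicovariance of a FODC on `H`: commuting right and left covariant
structures. -/
def FODC.IsBicovariantH (C : FODC k H Γ) (ΔΓ : Γ →ₗ[k] Γ ⊗[k] H)
    (ΛΓ : Γ →ₗ[k] H ⊗[k] Γ) : Prop :=
  FODC.IsRightCovariant (comulComod k H) C ΔΓ ∧ FODC.IsLeftCovariantH C ΛΓ ∧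
  LinearMap.rTensor H ΛΓ ∘ₗ ΔΓ =
    (TensorProduct.assoc k H Γ H).symm.toLinearMap ∘ₗ LinearMap.lTensor H ΔΓ ∘ₗ ΛΓ

/-- `D` is an extension of the coaction `ρ : A → A ⊗ H` to a morphism of first
order differential calculi `Γ_A → Ω¹(A ⊗ H) = (Γ_A ⊗ H) ⊕ (A ⊗ Γ_H)`, i.e.
a map covering `ρ`, `ρ`-bilinear and intertwining `d` with `d_⊗`. -/
def IsFirstOrderExt (S : ComodAlg k H A) (CA : FODC k A Γ) (CHf : FODC k H ΓH)
    (D : Γ →ₗ[k] (Γ ⊗[k] H) × (A ⊗[k] ΓH)) : Prop :=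
  (∀ a x, D (CA.lsmul a x) =
    (lactTH CA.lsmul (S.ρ a) (D x).1, lactHT CHf.lsmul (S.ρ a) (D x).2)) ∧
  (∀ a x, D (CA.rsmul a x) =
    (ractTH CA.rsmul (S.ρ a) (D x).1, ractHT CHf.rsmul (S.ρ a) (D x).2)) ∧
  D ∘ₗ CA.d =
    (LinearMap.rTensor H CA.d ∘ₗ S.ρ.toLinearMap).prod
      (LinearMap.lTensor A CHf.d ∘ₗ S.ρ.toLinearMap)

end FODCCov

/-! ## Vertical forms -/

section Vertical

variable {H : Type*} [Ring H] [HopfAlgebra k H]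
variable {A : Type*} [Ring A] [Algebra k A]
variable {ΩH : Type*} [Ring ΩH] [Algebra k ΩH]

/-- Two-sided multiplication `Ω ⊗ Ω →ₗ (Ω →ₗ Ω)`, `(x ⊗ z) ↦ (y ↦ x y z)`. -/
def bimul (Ω : Type*) [Ring Ω] [Algebra k Ω] : Ω ⊗[k] Ω →ₗ[k] Ω →ₗ[k] Ω :=
  TensorProduct.lift
    ((LinearMap.llcomp k Ω Ω Ω ∘ₗ LinearMap.mul k Ω).compl₂ (LinearMap.mul k Ω).flip)

/-- The right adjoint action `ω ↼ h = S(h₁) ω h₂` of `H` on forms `Ω(H)`. -/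
def adAct (CH : DiffCalc k H ΩH) : H →ₗ[k] ΩH →ₗ[k] ΩH :=
  bimul ΩH ∘ₗ
    TensorProduct.map (CH.ι.toLinearMap ∘ₗ HopfAlgebra.antipode (R := k))
      CH.ι.toLinearMap ∘ₗ
    Coalgebra.comul (R := k) (A := H)

/-- The Cartan–Maurer map `h ↦ ϖ(π_ε(h)) = S(h₁) d(h₂)`. -/
def cartan (CH : DiffCalc k H ΩH) : H →ₗ[k] ΩH :=
  LinearMap.mul' k ΩH ∘ₗ
    TensorProduct.map (CH.ι.toLinearMap ∘ₗ HopfAlgebra.antipode (R := k))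
      (CH.d ∘ₗ CH.ι.toLinearMap) ∘ₗ
    Coalgebra.comul (R := k) (A := H)

/-- The projection `π_Λ : ω ↦ S(ω₋₁) ω₀` onto left-coinvariant forms. -/
def piLam (CH : DiffCalc k H ΩH) (ΛL : ΩH →ₗ[k] H ⊗[k] ΩH) : ΩH →ₗ[k] ΩH :=
  LinearMap.mul' k ΩH ∘ₗ
    TensorProduct.map (CH.ι.toLinearMap ∘ₗ HopfAlgebra.antipode (R := k))
      LinearMap.id ∘ₗ ΛL

/-- The multiplication `(a ⊗ ϑ) ∧ (a' ⊗ ϑ') = a a'₍₀₎ ⊗ (ϑ ↼ a'₍₁₎) ∧ ϑ'` of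
vertical forms, as a map on the ambient space `A ⊗ Ω(H)`. -/
def verMul (S : ComodAlg k H A) (CH : DiffCalc k H ΩH) :
    (A ⊗[k] ΩH) ⊗[k] (A ⊗[k] ΩH) →ₗ[k] A ⊗[k] ΩH :=
  TensorProduct.map (LinearMap.mul' k A)
      (LinearMap.mul' k ΩH ∘ₗ
        LinearMap.rTensor ΩH (TensorProduct.lift (adAct CH).flip) ∘ₗ
        (TensorProduct.assoc k ΩH H ΩH).symm.toLinearMap) ∘ₗ
    (TensorProduct.tensorTensorTensorComm k A ΩH A (H ⊗[k] ΩH)).toLinearMap ∘ₗ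
    LinearMap.lTensor (A ⊗[k] ΩH)
      ((TensorProduct.assoc k A H ΩH).toLinearMap ∘ₗ
        LinearMap.rTensor ΩH S.ρ.toLinearMap)

/-- The vertical differential
`d_v(a ⊗ ϑ) = a ⊗ dϑ + a₍₀₎ ⊗ ϖ(π_ε(a₍₁₎)) ∧ ϑ`. -/
def verD (S : ComodAlg k H A) (CH : DiffCalc k H ΩH) :
    A ⊗[k] ΩH →ₗ[k] A ⊗[k] ΩH :=
  LinearMap.lTensor A CH.d +
    LinearMap.lTensor A
        (LinearMap.mul' k ΩH ∘ₗ LinearMap.rTensor ΩH (cartan CH)) ∘ₗ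
      (TensorProduct.assoc k A H ΩH).toLinearMap ∘ₗ
      LinearMap.rTensor ΩH S.ρ.toLinearMap

/-- The vertical forms `ver• = A ⊗ Λ•` as a submodule of `A ⊗ Ω(H)`. -/
def verSub (A : Type*) [Ring A] [Algebra k A] (ΛL : ΩH →ₗ[k] H ⊗[k] ΩH) :
    Submodule k (A ⊗[k] ΩH) :=
  LinearMap.range (LinearMap.lTensor A (leftCoinv ΛL).subtype)

/-- The degree-`n` vertical forms `ver^n = A ⊗ Λⁿ`. -/
def verSubN (A : Type*) [Ring A] [Algebra k A] (CH : DiffCalc k H ΩH)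
    (ΛL : ΩH →ₗ[k] H ⊗[k] ΩH) (n : ℕ) : Submodule k (A ⊗[k] ΩH) :=
  LinearMap.range (LinearMap.lTensor A ((leftCoinv ΛL ⊓ CH.grading n)).subtype)

end Vertical

/-! ## Quotient multiplications on balanced tensor products -/

section QuotMul

variable {A : Type*} [Ring A] [Algebra k A]

/-- Left multiplication (by `x`) on the first leg of `A ⊗ A`, followed by the
projection onto `A ⊗_B A`. -/
def lmulQaux (B : Submodule k A) (x : A) :
    A ⊗[k] A →ₗ[k] TensorOver (k := k) B :=
  (balRel B).mkQ ∘ₗ LinearMap.rTensor A (LinearMap.mul k A x)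

lemma lmulQaux_rel (B : Submodule k A) (x : A) :
    balRel (k := k) B ≤ LinearMap.ker (lmulQaux B x) := by
  refine Submodule.span_le.mpr ?_
  rintro z ⟨a, a', b, rfl⟩
  simp only [SetLike.mem_coe, LinearMap.mem_ker, lmulQaux, LinearMap.coe_comp,
    Function.comp_apply, map_sub, LinearMap.rTensor_tmul, LinearMap.mul_apply']
  rw [← map_sub, Submodule.mkQ_apply, Submodule.Quotient.mk_eq_zero]
  apply Submodule.subset_span
  exact ⟨x * a, a', b, by rw [mul_assoc]⟩

/-- Left multiplication on the first leg of `A ⊗_B A`. -/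
def lmulQ (B : Submodule k A) :
    A →ₗ[k] TensorOver (k := k) B →ₗ[k] TensorOver (k := k) B where
  toFun x := Submodule.liftQ _ (lmulQaux B x) (lmulQaux_rel B x)
  map_add' x y := by
    apply Submodule.linearMap_qext
    simp only [Submodule.liftQ_mkQ, LinearMap.add_comp, Submodule.liftQ_mkQ]
    simp only [lmulQaux, map_add, LinearMap.rTensor_add, LinearMap.comp_add]
  map_smul' c x := by
    apply Submodule.linearMap_qext
    simp only [RingHom.id_apply, Submodule.liftQ_mkQ, LinearMap.smul_comp,
      Submodule.liftQ_mkQ]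
    simp only [lmulQaux, map_smul, LinearMap.rTensor_smul, LinearMap.comp_smul]

/-- Right multiplication (by `x`) on the second leg of `A ⊗ A`, followed by
the projection onto `A ⊗_B A`. -/
def rmulQaux (B : Submodule k A) (x : A) :
    A ⊗[k] A →ₗ[k] TensorOver (k := k) B :=
  (balRel B).mkQ ∘ₗ LinearMap.lTensor A ((LinearMap.mul k A).flip x)

lemma rmulQaux_rel (B : Submodule k A) (x : A) :
    balRel (k := k) B ≤ LinearMap.ker (rmulQaux B x) := by
  refine Submodule.span_le.mpr ?_
  rintro z ⟨a, a', b, rfl⟩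
  simp only [SetLike.mem_coe, LinearMap.mem_ker, rmulQaux, LinearMap.coe_comp,
    Function.comp_apply, map_sub, LinearMap.lTensor_tmul, LinearMap.flip_apply,
    LinearMap.mul_apply']
  rw [← map_sub, Submodule.mkQ_apply, Submodule.Quotient.mk_eq_zero]
  apply Submodule.subset_span
  exact ⟨a, a' * x, b, by rw [mul_assoc]⟩

/-- Right multiplication on the second leg of `A ⊗_B A`. -/
def rmulQ (B : Submodule k A) :
    A →ₗ[k] TensorOver (k := k) B →ₗ[k] TensorOver (k := k) B where
  toFun x := Submodule.liftQ _ (rmulQaux B x) (rmulQaux_rel B x)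
  map_add' x y := by
    apply Submodule.linearMap_qext
    simp only [Submodule.liftQ_mkQ, LinearMap.add_comp, Submodule.liftQ_mkQ]
    simp only [rmulQaux, map_add, LinearMap.lTensor_add, LinearMap.comp_add]
  map_smul' c x := by
    apply Submodule.linearMap_qext
    simp only [RingHom.id_apply, Submodule.liftQ_mkQ, LinearMap.smul_comp,
      Submodule.liftQ_mkQ]
    simp only [rmulQaux, map_smul, LinearMap.lTensor_smul, LinearMap.comp_smul]

end QuotMul

/-! ## Base, horizontal and balanced graded forms -/

section GradedHG

variable {H : Type*} [Ring H] [HopfAlgebra k H]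
variable {A : Type*} [Ring A] [Algebra k A]
variable {ΩA : Type*} [Ring ΩA] [Algebra k ΩA]
variable {ΩH : Type*} [Ring ΩH] [Algebra k ΩH]

/-- The base forms `Ω•(B)`: forms invariant under the extended coaction. -/
def baseForms (D : ΩA →ₗ[k] ΩA ⊗[k] ΩH) : Submodule k ΩA where
  carrier := {ω | D ω = ω ⊗ₜ[k] 1}
  add_mem' := by
    intro a b ha hb
    simp only [Set.mem_setOf_eq] at *
    rw [map_add, ha, hb, TensorProduct.add_tmul]
  zero_mem' := by simp
  smul_mem' := by
    intro c a ha
    simp only [Set.mem_setOf_eq] at *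
    rw [map_smul, ha, TensorProduct.smul_tmul']

/-- The horizontal forms `hor• = (Δ_A•)⁻¹(Ω•(A) ⊗ H)`. -/
def horForms (CH : DiffCalc k H ΩH) (D : ΩA →ₗ[k] ΩA ⊗[k] ΩH) : Submodule k ΩA :=
  Submodule.comap D (LinearMap.range (LinearMap.lTensor ΩA CH.ι.toLinearMap))

/-- The lift `Ω(A) ⊗ Ω(A) → Ω(A) ⊗ Ω(H)`, `ω ⊗ η ↦ (ω ∧ η₍₀₎) ⊗ η₍₁₎` of the
graded canonical Hopf–Galois map. -/
def chiBulAux (D : ΩA →ₗ[k] ΩA ⊗[k] ΩH) : ΩA ⊗[k] ΩA →ₗ[k] ΩA ⊗[k] ΩH :=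
  LinearMap.rTensor ΩH (LinearMap.mul' k ΩA) ∘ₗ
    (TensorProduct.assoc k ΩA ΩA ΩH).symm.toLinearMap ∘ₗ LinearMap.lTensor ΩA D

end GradedHG

end NCG
namespace NCG

variable {k : Type*} [CommRing k]

section YDHelpers

variable {H : Type*} [Ring H] [HopfAlgebra k H]
variable {ΩH : Type*} [Ring ΩH] [Algebra k ΩH]

/-- `h ↦ h₂ ⊗ (h₁ ⊗ h₃)`. -/
def comul13 : H →ₗ[k] H ⊗[k] (H ⊗[k] H) :=
  (TensorProduct.assoc k H H H).toLinearMap ∘ₗ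
    LinearMap.rTensor H (TensorProduct.comm k H H).toLinearMap ∘ₗ
    (TensorProduct.assoc k H H H).symm.toLinearMap ∘ₗ
    LinearMap.lTensor H (Coalgebra.comul (R := k) (A := H)) ∘ₗ
    Coalgebra.comul (R := k) (A := H)

/-- The sandwich action `(g ⊗ g') ↦ (ω ↦ ι(S(g)) ω ι(g'))`. -/
def sandwich (CH : DiffCalc k H ΩH) : H ⊗[k] H →ₗ[k] ΩH →ₗ[k] ΩH :=
  bimul ΩH ∘ₗ
    TensorProduct.map (CH.ι.toLinearMap ∘ₗ HopfAlgebra.antipode (R := k))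
      CH.ι.toLinearMap

/-- The right hand side `(ϑ₍₁₎ ↼ h₂) ⊗ S(h₁) ϑ₍₂₎ h₃` of the Yetter–Drinfel'd
compatibility condition, evaluated on `t = ϑ₍₁₎ ⊗ ϑ₍₂₎`. -/
def ydRHS (CH : DiffCalc k H ΩH) (h : H) (t : ΩH ⊗[k] ΩH) : ΩH ⊗[k] ΩH :=
  (TensorProduct.map (TensorProduct.lift (adAct CH))
      (TensorProduct.lift (sandwich CH)) ∘ₗ
    (TensorProduct.tensorTensorTensorComm k H (H ⊗[k] H) ΩH ΩH).toLinearMap)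
    (comul13 (k := k) h ⊗ₜ[k] t)

/-- The canonical extension `Δ•_bc` of the comultiplication to a bicovariant
calculus: `Δ` on degree `0` and `Δ_R + _ΩΔ` in positive degrees. -/
def deltaBc (CH : DiffCalc k H ΩH) (ΔR : ΩH →ₗ[k] ΩH ⊗[k] H)
    (ΛL : ΩH →ₗ[k] H ⊗[k] ΩH) : ΩH →ₗ[k] ΩH ⊗[k] ΩH :=
  TensorProduct.map CH.ι.toLinearMap CH.ι.toLinearMap ∘ₗ
      Coalgebra.comul (R := k) (A := H) ∘ₗ CH.proj0 +
    (TensorProduct.map LinearMap.id CH.ι.toLinearMap ∘ₗ ΔR +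
        TensorProduct.map CH.ι.toLinearMap LinearMap.id ∘ₗ ΛL) ∘ₗ
      (LinearMap.id - CH.ι.toLinearMap ∘ₗ CH.proj0)

/-- The map `Ξ : ω ↦ ω₋₂ ⊗ S(ω₋₁) ω₀` from `Ω•(H)` to `H ⊗ Λ•`. -/
def XiMap (CH : DiffCalc k H ΩH) (ΛL : ΩH →ₗ[k] H ⊗[k] ΩH) :
    ΩH →ₗ[k] H ⊗[k] ΩH :=
  LinearMap.lTensor H (piLam CH ΛL) ∘ₗ ΛL

/-- The multiplication map `μ : h ⊗ ϑ ↦ ι(h) ϑ`. -/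
def muMap (CH : DiffCalc k H ΩH) : H ⊗[k] ΩH →ₗ[k] ΩH :=
  LinearMap.mul' k ΩH ∘ₗ TensorProduct.map CH.ι.toLinearMap LinearMap.id

end YDHelpers

end NCG
namespace NCG

variable {k : Type*} [CommRing k]

section Grading

variable {Ω : Type*} [Ring Ω] [Algebra k Ω]

lemma DGA.induction_homogeneous (C : DGA k Ω) {p : Ω → Prop} (x : Ω) (zero : p 0)
    (add : ∀ x y, p x → p y → p (x + y)) (mem : ∀ n, ∀ x ∈ C.grading n, p x) : p x := by
  have := C.gradedAlgebra
  exact DirectSum.Decomposition.inductionOn C.grading zero (fun m => mem _ _ m.2) add x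

lemma DGA.mul_mem (C : DGA k Ω) {i j : ℕ} {x y : Ω} (hx : x ∈ C.grading i)
    (hy : y ∈ C.grading j) : x * y ∈ C.grading (i + j) :=
  have := C.gradedAlgebra
  SetLike.mul_mem_graded hx hy

lemma DGA.projN_of_mem (C : DGA k Ω) {n : ℕ} {x : Ω} (hx : x ∈ C.grading n) :
    C.projN n x = x := by
  let := C.gradedAlgebra
  exact DirectSum.decompose_of_mem_same C.grading hx

lemma DGA.projN_of_mem_ne (C : DGA k Ω) {m n : ℕ} (hmn : m ≠ n) {x : Ω}
    (hx : x ∈ C.grading m) : C.projN n x = 0 := by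
  let := C.gradedAlgebra
  exact DirectSum.decompose_of_mem_ne C.grading hx hmn

lemma DGA.sign_of_mem (C : DGA k Ω) {n : ℕ} {x : Ω} (hx : x ∈ C.grading n) :
    C.sign x = ((-1 : k) ^ n) • x := by
  let := C.gradedAlgebra
  simp only [DGA.sign, LinearMap.coe_comp, LinearEquiv.coe_coe, Function.comp_apply,
    DirectSum.decomposeLinearEquiv_apply]
  rw [DirectSum.decompose_of_mem C.grading hx]
  erw [DirectSum.toModule_lof]
  rfl

lemma gradedBraid_of_mem (C : DGA k Ω) {M : Type*} [AddCommGroup M] [Module k M]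
    (s : M →ₗ[k] M) {n : ℕ} {x : Ω} (hx : x ∈ C.grading n) (m : M) :
    gradedBraid C s (x ⊗ₜ m) = (s ^ n) m ⊗ₜ x := by
  let := C.gradedAlgebra
  simp only [gradedBraid, LinearMap.coe_comp, LinearEquiv.coe_coe, Function.comp_apply,
    DirectSum.decomposeLinearEquiv_apply, TensorProduct.lift.tmul]
  rw [DirectSum.decompose_of_mem C.grading hx]
  erw [DirectSum.toModule_lof]
  rfl

variable {A : Type*} [Ring A] [Algebra k A]

lemma DiffCalc.proj0_ι (C : DiffCalc k A Ω) (a : A) : C.proj0 (C.ι a) = a := by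
  let := C.gradedAlgebra
  simp only [DiffCalc.proj0, LinearMap.coe_comp, LinearEquiv.coe_coe, Function.comp_apply,
    DirectSum.decomposeLinearEquiv_apply]
  rw [DirectSum.decompose_of_mem C.grading (C.ι_mem a), LinearEquiv.symm_apply_eq]
  erw [DirectSum.component.lof_self]

lemma DiffCalc.proj0_of_mem_ne (C : DiffCalc k A Ω) {n : ℕ} (hn : n ≠ 0) {x : Ω}
    (hx : x ∈ C.grading n) : C.proj0 x = 0 := by
  let := C.gradedAlgebra
  simp only [DiffCalc.proj0, LinearMap.coe_comp, LinearEquiv.coe_coe, Function.comp_apply,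
    DirectSum.decomposeLinearEquiv_apply]
  rw [LinearEquiv.map_eq_zero_iff]
  exact Subtype.ext (DirectSum.decompose_of_mem_ne C.grading hx hn)

@[simp]
lemma DiffCalc.proj0_d_ι (C : DiffCalc k A Ω) (a : A) : C.proj0 (C.d (C.ι a)) = 0 :=
  C.proj0_of_mem_ne one_ne_zero (C.d_ι_mem a)

lemma DiffCalc.proj0_mul (C : DiffCalc k A Ω) (x y : Ω) :
    C.proj0 (x * y) = C.proj0 x * C.proj0 y := by
  induction x using C.induction_homogeneous with
  | zero => simp
  | add x x' hx hx' => simp only [add_mul, map_add, hx, hx']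
  | mem i x hx =>
    induction y using C.induction_homogeneous with
    | zero => simp
    | add y y' hy hy' => simp only [mul_add, map_add, hy, hy']
    | mem j y hy =>
      rcases Nat.eq_zero_or_pos i with rfl | hi
      · rcases Nat.eq_zero_or_pos j with rfl | hj
        · obtain ⟨a, rfl⟩ := (C.range_ι x).1 hx
          obtain ⟨b, rfl⟩ := (C.range_ι y).1 hy
          rw [← map_mul, C.proj0_ι, C.proj0_ι, C.proj0_ι]
        · rw [C.proj0_of_mem_ne hj.ne' hy, mul_zero,
            C.proj0_of_mem_ne (by lia) (C.mul_mem hx hy)]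
      · rw [C.proj0_of_mem_ne hi.ne' hx, zero_mul,
          C.proj0_of_mem_ne (by lia) (C.mul_mem hx hy)]

lemma DiffCalc.d_ι_mul (C : DiffCalc k A Ω) (a b : A) :
    C.d (C.ι (a * b)) = C.d (C.ι a) * C.ι b + C.ι a * C.d (C.ι b) := by
  rw [map_mul, C.leibniz 0 _ (C.ι_mem a)]
  simp

/-- `a ⊗ b ↦ a db`. -/
def DiffCalc.oneForm (C : DiffCalc k A Ω) : A ⊗[k] A →ₗ[k] Ω :=
  LinearMap.mul' k Ω ∘ₗ TensorProduct.map C.ι.toLinearMap (C.d ∘ₗ C.ι.toLinearMap)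

@[simp]
lemma DiffCalc.oneForm_tmul (C : DiffCalc k A Ω) (a b : A) :
    C.oneForm (a ⊗ₜ b) = C.ι a * C.d (C.ι b) := rfl

lemma DiffCalc.oneForm_mem (C : DiffCalc k A Ω) (t : A ⊗[k] A) : C.oneForm t ∈ C.grading 1 := by
  induction t with
  | zero => simp
  | add t t' h h' => rw [map_add]; exact add_mem h h'
  | tmul a b => simpa using C.mul_mem (C.ι_mem a) (C.d_ι_mem b)

lemma DiffCalc.ι_mul_oneForm (C : DiffCalc k A Ω) (a : A) (t : A ⊗[k] A) :
    C.ι a * C.oneForm t ∈ LinearMap.range C.oneForm := by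
  induction t with
  | zero => simp
  | add t t' h h' => rw [map_add, mul_add]; exact add_mem h h'
  | tmul b c => exact ⟨(a * b) ⊗ₜ c, by simp [mul_assoc]⟩

lemma DiffCalc.oneForm_tmul_mul_ι (C : DiffCalc k A Ω) (b c a : A) :
    C.oneForm (b ⊗ₜ c) * C.ι a = C.oneForm (b ⊗ₜ (c * a) - (b * c) ⊗ₜ a) := by
  simp only [map_sub, C.oneForm_tmul, C.d_ι_mul, map_mul C.ι b c]
  noncomm_ring

lemma DiffCalc.oneForm_mul_ι (C : DiffCalc k A Ω) (a : A) (t : A ⊗[k] A) :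
    C.oneForm t * C.ι a ∈ LinearMap.range C.oneForm := by
  induction t with
  | zero => simp
  | add t t' h h' => rw [map_add, add_mul]; exact add_mem h h'
  | tmul b c => exact ⟨_, (C.oneForm_tmul_mul_ι b c a).symm⟩

lemma DiffCalc.projN_one_mul (C : DiffCalc k A Ω) (x y : Ω) :
    C.projN 1 (x * y) = C.ι (C.proj0 x) * C.projN 1 y + C.projN 1 x * C.ι (C.proj0 y) := by
  induction x using C.induction_homogeneous with
  | zero => simp
  | add x x' hx hx' => simp only [add_mul, map_add, hx, hx']; abel
  | mem i x hx =>
    induction y using C.induction_homogeneous with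
    | zero => simp
    | add y y' hy hy' => simp only [mul_add, map_add, hy, hy']; abel
    | mem j y hy =>
      have hxy := C.mul_mem hx hy
      by_cases hi : i = 0
      · subst hi
        obtain ⟨a, rfl⟩ := (C.range_ι x).1 hx
        rw [C.proj0_ι, C.projN_of_mem_ne zero_ne_one hx, zero_mul, add_zero]
        by_cases hj : j = 1
        · subst hj
          rw [C.projN_of_mem hy, C.projN_of_mem (by simpa using hxy)]
        · rw [C.projN_of_mem_ne hj hy, C.projN_of_mem_ne (by lia) hxy, mul_zero]
      · rw [C.proj0_of_mem_ne hi hx, map_zero, zero_mul, zero_add]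
        by_cases hj : j = 0
        · subst hj
          obtain ⟨b, rfl⟩ := (C.range_ι y).1 hy
          rw [C.proj0_ι]
          by_cases hi' : i = 1
          · subst hi'
            rw [C.projN_of_mem hx, C.projN_of_mem (by simpa using hxy)]
          · rw [C.projN_of_mem_ne hi' hx, C.projN_of_mem_ne (by lia) hxy, zero_mul]
        · rw [C.proj0_of_mem_ne hj hy, C.projN_of_mem_ne (by lia) hxy, map_zero, mul_zero]

lemma DiffCalc.projN_one_mem_range (C : DiffCalc k A Ω) (x : Ω) :
    C.projN 1 x ∈ LinearMap.range C.oneForm := by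
  have hx : x ∈ Algebra.adjoin k (Set.range C.ι ∪ ⇑C.d '' Set.range C.ι) :=
    C.generated ▸ Algebra.mem_top
  induction hx using Algebra.adjoin_induction with
  | mem x hx =>
    rcases hx with ⟨a, rfl⟩ | ⟨_, ⟨a, rfl⟩, rfl⟩
    · rw [C.projN_of_mem_ne zero_ne_one (C.ι_mem a)]; exact zero_mem _
    · rw [C.projN_of_mem (C.d_ι_mem a)]
      exact ⟨1 ⊗ₜ a, by simp⟩
  | algebraMap r =>
    rw [← C.ι.commutes r, C.projN_of_mem_ne zero_ne_one (C.ι_mem _)]; exact zero_mem _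
  | add x y _ _ hx hy => rw [map_add]; exact add_mem hx hy
  | mul x y _ _ hx hy =>
    obtain ⟨t, ht⟩ := hx
    obtain ⟨u, hu⟩ := hy
    rw [C.projN_one_mul, ← ht, ← hu]
    exact add_mem (C.ι_mul_oneForm _ _) (C.oneForm_mul_ι _ _)

lemma DiffCalc.exists_oneForm (C : DiffCalc k A Ω) {x : Ω} (hx : x ∈ C.grading 1) :
    ∃ t, C.oneForm t = x := by
  simpa [C.projN_of_mem hx] using C.projN_one_mem_range x

end Grading

section Koszul

variable {Ω : Type*} [Ring Ω] [Algebra k Ω]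
variable {Ξ : Type*} [Ring Ξ] [Algebra k Ξ]

lemma koszulMul_tmul_of_mem (CM : DGA k Ω) (CN : DGA k Ξ) {n : ℕ} {θ : Ξ}
    (hθ : θ ∈ CN.grading n) (m m' : Ω) (θ' : Ξ) :
    koszulMul CM CN ((m ⊗ₜ θ) ⊗ₜ (m' ⊗ₜ θ')) = (m * (CM.sign ^ n) m') ⊗ₜ (θ * θ') := by
  simp [koszulMul, koszulMulGen, gradedBraid_of_mem CN _ hθ]

variable {H : Type*} [Ring H] [Algebra k H]

lemma lTensor_proj0_koszulMul (CM : DGA k Ω) (CN : DiffCalc k H Ξ) (u v : Ω ⊗[k] Ξ) :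
    LinearMap.lTensor Ω CN.proj0 (koszulMul CM CN.toDGA (u ⊗ₜ v)) =
      LinearMap.lTensor Ω CN.proj0 u * LinearMap.lTensor Ω CN.proj0 v := by
  induction v with
  | zero => simp
  | add v v' hv hv' => simp only [tmul_add, map_add, hv, hv', mul_add]
  | tmul m' θ' =>
    induction u with
    | zero => simp
    | add u u' hu hu' => simp only [add_tmul, map_add, hu, hu', add_mul]
    | tmul m θ =>
      induction θ using CN.induction_homogeneous with
      | zero => simp
      | add θ₁ θ₂ h₁ h₂ => simp only [tmul_add, add_tmul, map_add, h₁, h₂, add_mul]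
      | mem n θ hθ =>
        rw [koszulMul_tmul_of_mem CM CN.toDGA hθ]
        simp only [LinearMap.lTensor_tmul, CN.proj0_mul, Algebra.TensorProduct.tmul_mul_tmul]
        by_cases hn : n = 0
        · subst hn; simp
        · simp [CN.proj0_of_mem_ne hn hθ]

/-- The product of `(Ω ⊗ Ξ) ⊗ H`, with Koszul signs between `Ω` and `Ξ` only. -/
def koszulMulRight (CM : DGA k Ω) (CN : DGA k Ξ) (H : Type*) [Ring H] [Algebra k H] :
    ((Ω ⊗[k] Ξ) ⊗[k] H) ⊗[k] ((Ω ⊗[k] Ξ) ⊗[k] H) →ₗ[k] (Ω ⊗[k] Ξ) ⊗[k] H :=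
  TensorProduct.map (koszulMul CM CN) (LinearMap.mul' k H) ∘ₗ
    (TensorProduct.tensorTensorTensorComm k (Ω ⊗[k] Ξ) H (Ω ⊗[k] Ξ) H).toLinearMap

@[simp]
lemma koszulMulRight_tmul (CM : DGA k Ω) (CN : DGA k Ξ) (u v : Ω ⊗[k] Ξ) (g h : H) :
    koszulMulRight CM CN H ((u ⊗ₜ g) ⊗ₜ (v ⊗ₜ h)) = koszulMul CM CN (u ⊗ₜ v) ⊗ₜ (g * h) := by
  simp [koszulMulRight]

lemma assoc_symm_lTensor_koszulMul (CM : DGA k Ω) (CN : DGA k Ξ) (P : Ξ →ₗ[k] Ξ ⊗[k] H)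
    (hmul : ∀ x y, P (x * y) = P x * P y)
    (hdeg : ∀ n, ∀ x ∈ CN.grading n, P x ∈ LinearMap.range ((CN.grading n).subtype.rTensor H))
    (u v : Ω ⊗[k] Ξ) :
    (TensorProduct.assoc k Ω Ξ H).symm (P.lTensor Ω (koszulMul CM CN (u ⊗ₜ v))) =
      koszulMulRight CM CN H ((TensorProduct.assoc k Ω Ξ H).symm (P.lTensor Ω u) ⊗ₜ
        (TensorProduct.assoc k Ω Ξ H).symm (P.lTensor Ω v)) := by
  induction v with
  | zero => simp
  | add v v' hv hv' => simp only [tmul_add, map_add, hv, hv']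
  | tmul m' θ' =>
    induction u with
    | zero => simp
    | add u u' hu hu' => simp only [add_tmul, map_add, hu, hu']
    | tmul m θ =>
      induction θ using CN.induction_homogeneous with
      | zero => simp
      | add θ₁ θ₂ h₁ h₂ => simp only [tmul_add, add_tmul, map_add, h₁, h₂]
      | mem n θ hθ =>
        rw [koszulMul_tmul_of_mem CM CN hθ]
        obtain ⟨p, hp⟩ := hdeg n θ hθ
        simp only [LinearMap.lTensor_tmul, hmul, ← hp]
        generalize P θ' = q
        clear hp
        induction p with
        | zero => simp
        | add p p' h h' => simp only [tmul_add, add_tmul, map_add, h, h', add_mul]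
        | tmul x g =>
          induction q with
          | zero => simp
          | add q q' h h' => simp only [tmul_add, map_add, h, h', mul_add]
          | tmul y h => simp [koszulMul_tmul_of_mem CM CN x.2]

end Koszul

section CompleteExt

variable {H : Type*} [Ring H] [HopfAlgebra k H]
variable {A : Type*} [Ring A] [Algebra k A]
variable {ΩA : Type*} [Ring ΩA] [Algebra k ΩA]
variable {ΩH : Type*} [Ring ΩH] [Algebra k ΩH]
variable {S : ComodAlg k H A} {CA : DiffCalc k A ΩA} {CH : DiffCalc k H ΩH}
variable {DA : ΩA →ₗ[k] ΩA ⊗[k] ΩH} {DH : ΩH →ₗ[k] ΩH ⊗[k] ΩH}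

lemma ComodAlg.map_map_coassoc (S : ComodAlg k H A) {M N P : Type*} [AddCommMonoid M]
    [Module k M] [AddCommMonoid N] [Module k N] [AddCommMonoid P] [Module k P] (f : A →ₗ[k] M)
    (g : H →ₗ[k] N) (h : H →ₗ[k] P) (a : A) :
    TensorProduct.map (TensorProduct.map f g ∘ₗ S.ρ.toLinearMap) h (S.ρ a) =
      (TensorProduct.assoc k M N P).symm (TensorProduct.map f
        (TensorProduct.map g h ∘ₗ Coalgebra.comul (R := k) (A := H)) (S.ρ a)) := by
  have coassoc := congr(TensorProduct.map f (TensorProduct.map g h) ($(S.coaction.2) a))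
  have hassoc (t) : TensorProduct.map f (TensorProduct.map g h) (TensorProduct.assoc k A H H t) =
      TensorProduct.assoc k M N P (TensorProduct.map (TensorProduct.map f g) h t) :=
    congr($(TensorProduct.map_map_comp_assoc_eq f g h) t)
  simp only [LinearMap.coe_comp, Function.comp_apply, LinearEquiv.coe_coe,
    AlgHom.toLinearMap_apply, LinearMap.rTensor, LinearMap.lTensor, hassoc] at coassoc
  rw [LinearEquiv.eq_symm_apply, ← h.comp_id, TensorProduct.map_comp, ← f.comp_id,
    TensorProduct.map_comp f]
  simpa using coassoc

namespace IsCompleteExt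

lemma apply_ι (hDA : IsCompleteExt S CA CH DA) (a : A) :
    DA (CA.ι a) = TensorProduct.map CA.ι.toLinearMap CH.ι.toLinearMap (S.ρ a) :=
  congr($(hDA.2.2.1) a)

lemma apply_d_ι (hDA : IsCompleteExt S CA CH DA) (a : A) :
    DA (CA.d (CA.ι a)) =
      TensorProduct.map (CA.d ∘ₗ CA.ι.toLinearMap) CH.ι.toLinearMap (S.ρ a) +
      TensorProduct.map CA.ι.toLinearMap (CH.d ∘ₗ CH.ι.toLinearMap) (S.ρ a) := by
  have h := congr($(hDA.2.2.2.1) (CA.ι a))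
  simp only [LinearMap.coe_comp, Function.comp_apply] at h
  rw [h, hDA.apply_ι]
  generalize S.ρ a = u
  induction u with
  | zero => simp
  | add u v hu hv => simp only [map_add, hu, hv]; abel
  | tmul a h => simp [dTensorGen, CA.sign_of_mem (CA.ι_mem a)]

lemma lTensor_proj0_mul (hDA : IsCompleteExt S CA CH DA) (x y : ΩA) :
    LinearMap.lTensor ΩA CH.proj0 (DA (x * y)) =
      LinearMap.lTensor ΩA CH.proj0 (DA x) * LinearMap.lTensor ΩA CH.proj0 (DA y) := by
  rw [hDA.2.1, lTensor_proj0_koszulMul]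

lemma lTensor_proj0_ι (hDA : IsCompleteExt S CA CH DA) (a : A) :
    LinearMap.lTensor ΩA CH.proj0 (DA (CA.ι a)) = CA.ι.toLinearMap.rTensor H (S.ρ a) := by
  rw [hDA.apply_ι]
  generalize S.ρ a = u
  induction u with
  | zero => simp
  | add u v hu hv => simp only [map_add, hu, hv]
  | tmul a h => simp [CH.proj0_ι]

lemma lTensor_proj0_d_ι (hDA : IsCompleteExt S CA CH DA) (a : A) :
    LinearMap.lTensor ΩA CH.proj0 (DA (CA.d (CA.ι a))) =
      (CA.d ∘ₗ CA.ι.toLinearMap).rTensor H (S.ρ a) := by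
  rw [hDA.apply_d_ι]
  generalize S.ρ a = u
  induction u with
  | zero => simp
  | add u v hu hv => simp only [map_add] at hu hv ⊢; rw [← hu, ← hv]; abel
  | tmul a h => simp [CH.proj0_ι]

lemma lTensor_proj0_mem (hDA : IsCompleteExt S CA CH DA) (n : ℕ) (x : ΩA)
    (hx : x ∈ CA.grading n) :
    LinearMap.lTensor ΩA CH.proj0 (DA x) ∈
      LinearMap.range ((CA.grading n).subtype.rTensor H) := by
  suffices tensorGrading CA.grading CH.grading n ≤
      (LinearMap.range ((CA.grading n).subtype.rTensor H)).comap
        (LinearMap.lTensor ΩA CH.proj0) from this (hDA.2.2.2.2 n x hx)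
  refine iSup_le ?_
  rintro ⟨⟨i, j⟩, hij⟩ _ ⟨t, rfl⟩
  dsimp only at hij t ⊢
  rw [Submodule.mem_comap]
  induction t with
  | zero => simp
  | add t t' h h' => simp only [map_add]; exact add_mem h h'
  | tmul y θ =>
    by_cases hj : j = 0
    · obtain rfl : i = n := by lia
      exact ⟨y ⊗ₜ CH.proj0 θ, by simp⟩
    · simp [CH.proj0_of_mem_ne hj θ.2]

lemma rTensor_lTensor_proj0 (hDA : IsCompleteExt S CA CH DA) (hDH : IsCompleteExtH CH DH)
    (x : ΩA) :
    DA.rTensor H (LinearMap.lTensor ΩA CH.proj0 (DA x)) =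
      (TensorProduct.assoc k ΩA ΩH H).symm
        (LinearMap.lTensor ΩA (LinearMap.lTensor ΩH CH.proj0 ∘ₗ DH) (DA x)) := by
  have hι : (LinearMap.lTensor ΩH CH.proj0 ∘ₗ DH) ∘ₗ CH.ι.toLinearMap =
      TensorProduct.map CH.ι.toLinearMap .id ∘ₗ Coalgebra.comul (R := k) (A := H) :=
    LinearMap.ext hDH.lTensor_proj0_ι
  have hd : (LinearMap.lTensor ΩH CH.proj0 ∘ₗ DH) ∘ₗ CH.d ∘ₗ CH.ι.toLinearMap =
      TensorProduct.map (CH.d ∘ₗ CH.ι.toLinearMap) .id ∘ₗ Coalgebra.comul (R := k) (A := H) :=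
    LinearMap.ext hDH.lTensor_proj0_d_ι
  have hι' : DA ∘ₗ CA.ι.toLinearMap =
      TensorProduct.map CA.ι.toLinearMap CH.ι.toLinearMap ∘ₗ S.ρ.toLinearMap :=
    LinearMap.ext hDA.apply_ι
  have hd' : DA ∘ₗ CA.d ∘ₗ CA.ι.toLinearMap =
      TensorProduct.map (CA.d ∘ₗ CA.ι.toLinearMap) CH.ι.toLinearMap ∘ₗ S.ρ.toLinearMap +
      TensorProduct.map CA.ι.toLinearMap (CH.d ∘ₗ CH.ι.toLinearMap) ∘ₗ S.ρ.toLinearMap :=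
    LinearMap.ext hDA.apply_d_ι
  have hx : x ∈ Algebra.adjoin k (Set.range CA.ι ∪ ⇑CA.d '' Set.range CA.ι) :=
    CA.generated ▸ Algebra.mem_top
  induction hx using Algebra.adjoin_induction with
  | mem x hx =>
    rcases hx with ⟨a, rfl⟩ | ⟨_, ⟨a, rfl⟩, rfl⟩
    · rw [hDA.lTensor_proj0_ι, hDA.apply_ι, LinearMap.rTensor, LinearMap.rTensor,
        LinearMap.lTensor, TensorProduct.map_map, TensorProduct.map_map, hι, hι']
      exact S.map_map_coassoc _ _ _ _
    · rw [hDA.lTensor_proj0_d_ι, hDA.apply_d_ι, LinearMap.rTensor, LinearMap.rTensor,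
        LinearMap.lTensor, map_add, TensorProduct.map_map, TensorProduct.map_map,
        TensorProduct.map_map, hι, hd, hd', LinearMap.id_comp, LinearMap.id_comp,
        LinearMap.id_comp, map_add, ← S.map_map_coassoc, ← S.map_map_coassoc,
        TensorProduct.map_add_left, LinearMap.add_apply]
  | algebraMap r =>
    rw [← CA.ι.commutes r, hDA.lTensor_proj0_ι, hDA.apply_ι, LinearMap.rTensor,
      LinearMap.rTensor, LinearMap.lTensor, TensorProduct.map_map, TensorProduct.map_map, hι, hι']
    exact S.map_map_coassoc _ _ _ _
  | add x y _ _ hx hy => simp only [map_add, hx, hy]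
  | mul x y _ _ hx hy =>
    rw [hDA.2.1 x y, assoc_symm_lTensor_koszulMul CA.toDGA CH.toDGA _ hDH.lTensor_proj0_mul
      hDH.lTensor_proj0_mem, ← hx, ← hy, lTensor_proj0_koszulMul]
    generalize LinearMap.lTensor ΩA CH.proj0 (DA x) = u
    generalize LinearMap.lTensor ΩA CH.proj0 (DA y) = v
    induction v with
    | zero => simp
    | add v v' hv hv' => simp only [tmul_add, map_add, hv, hv', mul_add]
    | tmul m' θ' =>
      induction u with
      | zero => simp
      | add u u' hu hu' => simp only [add_tmul, map_add, hu, hu', add_mul]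
      | tmul m θ => simp [hDA.2.1]

end IsCompleteExt

end CompleteExt

section CartanMaurer

open WithConv

variable {H : Type*} [Ring H] [HopfAlgebra k H]
variable {A : Type*} [Ring A] [Algebra k A]
variable {ΩH : Type*} [Ring ΩH] [Algebra k ΩH]

lemma conv_algHom_comp_antipode_mul (f : H →ₐ[k] A) :
    toConv (f.toLinearMap ∘ₗ HopfAlgebra.antipode (R := k)) * toConv f.toLinearMap = 1 := by
  have h := LinearMap.algHom_comp_convMul_distrib f (toConv (HopfAlgebra.antipode k (A := H)))
    (toConv .id)
  rw [LinearMap.antipode_mul_id] at h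
  simp only [LinearMap.comp_id] at h
  apply WithConv.ext
  rw [← h]
  ext x
  simp [LinearMap.convOne_def]

lemma conv_algHom_mul_comp_antipode (f : H →ₐ[k] A) :
    toConv f.toLinearMap * toConv (f.toLinearMap ∘ₗ HopfAlgebra.antipode (R := k)) = 1 := by
  have h := LinearMap.algHom_comp_convMul_distrib f (toConv .id)
    (toConv (HopfAlgebra.antipode k (A := H)))
  rw [LinearMap.id_mul_antipode] at h
  simp only [LinearMap.comp_id] at h
  apply WithConv.ext
  rw [← h]
  ext x
  simp [LinearMap.convOne_def]

variable (CH : DiffCalc k H ΩH)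

lemma toConv_cartan :
    toConv (cartan CH) = toConv (CH.ι.toLinearMap ∘ₗ HopfAlgebra.antipode (R := k)) *
      toConv (CH.d ∘ₗ CH.ι.toLinearMap) := rfl

lemma mul_map_ι_cartan :
    LinearMap.mul' k ΩH ∘ₗ TensorProduct.map CH.ι.toLinearMap (cartan CH) ∘ₗ
      Coalgebra.comul (R := k) (A := H) = CH.d ∘ₗ CH.ι.toLinearMap := by
  apply toConv_injective
  change toConv CH.ι.toLinearMap * toConv (cartan CH) = _
  rw [toConv_cartan, ← mul_assoc, conv_algHom_mul_comp_antipode, one_mul]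

lemma mul_map_antipode_comul (h : H) :
    LinearMap.mul' k H (TensorProduct.map (HopfAlgebra.antipode k) .id
      (Coalgebra.comul (R := k) h)) = algebraMap k H (Coalgebra.counit h) :=
  HopfAlgebra.mul_antipode_rTensor_comul_apply h

lemma bimul_tmul (x y z : ΩH) : bimul (k := k) ΩH (x ⊗ₜ y) z = x * z * y := by
  simp [bimul, mul_assoc]

lemma adAct_one (h : H) : adAct CH h 1 = algebraMap k ΩH (Coalgebra.counit h) := by
  rw [← CH.ι.commutes, ← mul_map_antipode_comul]
  simp only [adAct, LinearMap.coe_comp, Function.comp_apply]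
  generalize Coalgebra.comul (R := k) h = u
  induction u with
  | zero => simp
  | add u v hu hv => simp only [map_add, LinearMap.add_apply, hu, hv]
  | tmul x y => simp [bimul_tmul]

lemma cartan_mul (g h : H) :
    cartan CH (g * h) = adAct CH h (cartan CH g) + Coalgebra.counit (R := k) g • cartan CH h := by
  have key (u v : H ⊗[k] H) :
      LinearMap.mul' k ΩH (TensorProduct.map (CH.ι.toLinearMap ∘ₗ HopfAlgebra.antipode (R := k))
        (CH.d ∘ₗ CH.ι.toLinearMap) (u * v)) =
      bimul ΩH (TensorProduct.map (CH.ι.toLinearMap ∘ₗ HopfAlgebra.antipode (R := k))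
        CH.ι.toLinearMap v) (LinearMap.mul' k ΩH (TensorProduct.map
          (CH.ι.toLinearMap ∘ₗ HopfAlgebra.antipode (R := k)) (CH.d ∘ₗ CH.ι.toLinearMap) u)) +
      LinearMap.mul' k ΩH (LinearMap.lTensor ΩH
        (LinearMap.mulLeft k (CH.ι (LinearMap.mul' k H
          (TensorProduct.map (HopfAlgebra.antipode k) .id u))))
        (TensorProduct.map (CH.ι.toLinearMap ∘ₗ HopfAlgebra.antipode (R := k))
          (CH.d ∘ₗ CH.ι.toLinearMap) v)) := by
    induction v with
    | zero => simp
    | add v v' hv hv' =>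
      simp only [mul_add, map_add, hv, hv', LinearMap.add_apply]; abel
    | tmul x' y' =>
      induction u with
      | zero => simp
      | add u u' hu hu' =>
        simp only [add_mul, map_add, hu, hu']
        simp [mul_add, add_mul]; abel
      | tmul x y =>
        have hd := CH.d_ι_mul y y'
        rw [map_mul] at hd
        simp [bimul_tmul, HopfAlgebra.antipode_mul_antidistrib, hd, mul_add, mul_assoc]
  have h1 := key (Coalgebra.comul g) (Coalgebra.comul h)
  rw [mul_map_antipode_comul, ← Bialgebra.comul_mul, AlgHom.commutes] at h1
  refine h1.trans (congr($rfl + $(?_)))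
  have hmul (c : k) (t : ΩH ⊗[k] ΩH) : LinearMap.mul' k ΩH (LinearMap.lTensor ΩH
      (LinearMap.mulLeft k (algebraMap k ΩH c)) t) = c • LinearMap.mul' k ΩH t := by
    induction t with
    | zero => simp
    | add t t' h h' => simp only [map_add, smul_add, h, h']
    | tmul x y => simp [← Algebra.smul_def]
  exact hmul _ _

variable {CH}

lemma toConv_algHom_comp_cartan {B : Type*} [Ring B] [Algebra k B] (f : ΩH →ₐ[k] B) :
    toConv (f.toLinearMap ∘ₗ cartan CH) =
      toConv ((f.comp CH.ι).toLinearMap ∘ₗ HopfAlgebra.antipode (R := k)) *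
        toConv (f.toLinearMap ∘ₗ CH.d ∘ₗ CH.ι.toLinearMap) :=
  WithConv.ext (LinearMap.algHom_comp_convMul_distrib f _ _)

lemma conv_algHom_comp_cartan {B : Type*} [Ring B] [Algebra k B] {P inl : ΩH →ₐ[k] B}
    {inr : H →ₐ[k] B}
    (hι : toConv (P.comp CH.ι).toLinearMap =
      toConv (inl.comp CH.ι).toLinearMap * toConv inr.toLinearMap)
    (hd : toConv (P.toLinearMap ∘ₗ CH.d ∘ₗ CH.ι.toLinearMap) =
      toConv (inl.toLinearMap ∘ₗ CH.d ∘ₗ CH.ι.toLinearMap) * toConv inr.toLinearMap) :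
    toConv inr.toLinearMap * toConv (P.toLinearMap ∘ₗ cartan CH) =
      toConv (inl.toLinearMap ∘ₗ cartan CH) * toConv inr.toLinearMap := by
  have hinr : toConv inr.toLinearMap =
      toConv ((inl.comp CH.ι).toLinearMap ∘ₗ HopfAlgebra.antipode (R := k)) *
        toConv (P.comp CH.ι).toLinearMap := by
    rw [hι, ← mul_assoc, conv_algHom_comp_antipode_mul, one_mul]
  rw [toConv_algHom_comp_cartan, toConv_algHom_comp_cartan, mul_assoc, ← hd]
  conv_lhs => rw [hinr]
  rw [mul_assoc, ← mul_assoc (toConv (P.comp CH.ι).toLinearMap), conv_algHom_mul_comp_antipode,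
    one_mul]

lemma map_id_comp_comul (f : H →ₗ[k] ΩH) :
    TensorProduct.map f .id ∘ₗ Coalgebra.comul (R := k) (A := H) =
      LinearMap.mul' k (ΩH ⊗[k] H) ∘ₗ
        TensorProduct.map (Algebra.TensorProduct.includeLeft (R := k) (S := k)
            (B := H).toLinearMap ∘ₗ f)
          Algebra.TensorProduct.includeRight.toLinearMap ∘ₗ
        Coalgebra.comul (R := k) (A := H) := by
  ext x
  simp only [LinearMap.coe_comp, Function.comp_apply]
  generalize Coalgebra.comul (R := k) x = u
  induction u with
  | zero => simp
  | add u v hu hv => simp only [map_add, hu, hv]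
  | tmul x y => simp

lemma mul_includeRight_map_cartan {DH : ΩH →ₗ[k] ΩH ⊗[k] ΩH} (hDH : IsCompleteExtH CH DH) :
    LinearMap.mul' k (ΩH ⊗[k] H) ∘ₗ
      TensorProduct.map Algebra.TensorProduct.includeRight.toLinearMap
        ((LinearMap.lTensor ΩH CH.proj0 ∘ₗ DH) ∘ₗ cartan CH) ∘ₗ
      Coalgebra.comul (R := k) (A := H) =
    TensorProduct.map (cartan CH) .id ∘ₗ Coalgebra.comul (R := k) (A := H) := by
  obtain ⟨P, hP⟩ : ∃ P : ΩH →ₐ[k] ΩH ⊗[k] H,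
      P.toLinearMap = LinearMap.lTensor ΩH CH.proj0 ∘ₗ DH :=
    ⟨AlgHom.ofLinearMap (LinearMap.lTensor ΩH CH.proj0 ∘ₗ DH)
      (by
        rw [← map_one CH.ι]
        refine (hDH.lTensor_proj0_ι 1).trans ?_
        simp [comulComod, Algebra.TensorProduct.one_def])
      hDH.lTensor_proj0_mul, rfl⟩
  have hι : P.toLinearMap ∘ₗ CH.ι.toLinearMap =
      TensorProduct.map CH.ι.toLinearMap .id ∘ₗ Coalgebra.comul (R := k) (A := H) :=
    hP ▸ LinearMap.ext hDH.lTensor_proj0_ι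
  have hd : P.toLinearMap ∘ₗ CH.d ∘ₗ CH.ι.toLinearMap =
      TensorProduct.map (CH.d ∘ₗ CH.ι.toLinearMap) .id ∘ₗ Coalgebra.comul (R := k) (A := H) :=
    hP ▸ LinearMap.ext hDH.lTensor_proj0_d_ι
  rw [← hP]
  rw [map_id_comp_comul] at hι hd ⊢
  exact congr(ofConv $(conv_algHom_comp_cartan (CH := CH) (P := P)
    (inl := Algebra.TensorProduct.includeLeft) (inr := Algebra.TensorProduct.includeRight)
    (congr(toConv $hι)) (congr(toConv $hd))))

end CartanMaurer

section LeftCovariant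

variable {H : Type*} [Ring H] [HopfAlgebra k H]
variable {ΩH : Type*} [Ring ΩH] [Algebra k ΩH]
variable {CH : DiffCalc k H ΩH} {ΛL : ΩH →ₗ[k] H ⊗[k] ΩH}

namespace IsLeftCovariantH

lemma piLam_ι_mul (hΛ : IsLeftCovariantH CH ΛL) (h : H) (θ : ΩH) :
    piLam CH ΛL (CH.ι h * θ) = Coalgebra.counit (R := k) h • piLam CH ΛL θ := by
  have hι : ΛL (CH.ι h) = LinearMap.lTensor H CH.ι.toLinearMap (Coalgebra.comul (R := k) h) :=
    congr($(hΛ.2.2.2.2.2) h)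
  have key (u : H ⊗[k] H) (z : H) (η : ΩH) : LinearMap.mul' k ΩH
      (TensorProduct.map (CH.ι.toLinearMap ∘ₗ HopfAlgebra.antipode (R := k)) .id
        (LinearMap.lTensor H CH.ι.toLinearMap u * z ⊗ₜ η)) =
      CH.ι (HopfAlgebra.antipode k z) * (CH.ι (LinearMap.mul' k H
        (TensorProduct.map (HopfAlgebra.antipode k) .id u)) * η) := by
    induction u with
    | zero => simp
    | add u v hu hv => simp only [map_add, add_mul, mul_add, hu, hv]
    | tmul x y => simp [HopfAlgebra.antipode_mul_antidistrib, mul_assoc]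
  simp only [piLam, LinearMap.coe_comp, Function.comp_apply, hΛ.2.2.1, hι]
  generalize ΛL θ = w
  induction w with
  | zero => simp
  | add w w' hw hw' => simp only [mul_add, map_add, smul_add, hw, hw']
  | tmul z η =>
    rw [key, mul_map_antipode_comul, AlgHom.commutes]
    simp [← Algebra.smul_def]

lemma piLam_d_ι (hΛ : IsLeftCovariantH CH ΛL) (h : H) :
    piLam CH ΛL (CH.d (CH.ι h)) = cartan CH h := by
  have hd : ΛL (CH.d (CH.ι h)) =
      LinearMap.lTensor H CH.d (LinearMap.lTensor H CH.ι.toLinearMap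
        (Coalgebra.comul (R := k) h)) := by
    refine congr($(hΛ.2.2.2.2.1) (CH.ι h)).trans ?_
    exact congr(LinearMap.lTensor H CH.d ($(hΛ.2.2.2.2.2) h))
  simp only [piLam, cartan, LinearMap.coe_comp, Function.comp_apply, hd]
  generalize Coalgebra.comul (R := k) h = u
  induction u with
  | zero => simp
  | add u v hu hv => simp only [map_add, hu, hv]
  | tmul x y => simp

lemma exists_cartan (hΛ : IsLeftCovariantH CH ΛL) {θ : ΩH} (hθ : θ ∈ leftCoinv ΛL)
    (hθ1 : θ ∈ CH.grading 1) : ∃ h, cartan CH h = θ := by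
  have hfix : piLam CH ΛL θ = θ := by
    have : ΛL θ = 1 ⊗ₜ θ := hθ
    simp [piLam, this]
  obtain ⟨t, rfl⟩ := CH.exists_oneForm hθ1
  rw [← hfix]
  change _ ∈ LinearMap.range (cartan CH)
  clear hfix hθ1 hθ
  induction t with
  | zero => simp
  | add t t' h h' => simp only [map_add]; exact add_mem h h'
  | tmul g h =>
    rw [CH.oneForm_tmul, hΛ.piLam_ι_mul, hΛ.piLam_d_ι]
    exact Submodule.smul_mem _ _ ⟨h, rfl⟩

end IsLeftCovariantH

end LeftCovariant

section VerticalProjection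

variable {H : Type*} [Ring H] [HopfAlgebra k H]
variable {A : Type*} [Ring A] [Algebra k A]
variable {ΩA : Type*} [Ring ΩA] [Algebra k ΩA]
variable {ΩH : Type*} [Ring ΩH] [Algebra k ΩH]
variable (S : ComodAlg k H A) {CA : DiffCalc k A ΩA} {CH : DiffCalc k H ΩH}
variable {ΛL : ΩH →ₗ[k] H ⊗[k] ΩH}
variable {DA : ΩA →ₗ[k] ΩA ⊗[k] ΩH} {DH : ΩH →ₗ[k] ΩH ⊗[k] ΩH}

lemma chiAux_tmul (a b : A) : chiAux S (a ⊗ₜ b) = a ⊗ₜ 1 * S.ρ b := by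
  simp [chiAux]

lemma ComodAlg.lTensor_counit_ρ (a : A) :
    LinearMap.lTensor A (Coalgebra.counit (R := k) (A := H)) (S.ρ a) = a ⊗ₜ 1 :=
  congr($(S.coaction.1) a)

lemma ComodAlg.rid_lTensor_counit_chiAux (t : A ⊗[k] A) :
    TensorProduct.rid k A (LinearMap.lTensor A (Coalgebra.counit (R := k) (A := H))
      (chiAux S t)) = LinearMap.mul' k A t := by
  have key (a : A) (u : A ⊗[k] H) :
      TensorProduct.rid k A (LinearMap.lTensor A (Coalgebra.counit (R := k) (A := H))
        (a ⊗ₜ 1 * u)) = a * TensorProduct.rid k A (LinearMap.lTensor A Coalgebra.counit u) := by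
    induction u with
    | zero => simp
    | add u v hu hv => simp only [mul_add, map_add, hu, hv]
    | tmul b h => simp
  induction t with
  | zero => simp
  | add t t' h h' => simp only [map_add, h, h']
  | tmul a b => rw [chiAux_tmul, key, S.lTensor_counit_ρ]; simp

lemma lTensor_tmul_one_mul {M N : Type*} [Ring M] [Algebra k M] [Ring N] [Algebra k N]
    (f : M →ₗ[k] N) (a : A) (u : A ⊗[k] M) :
    LinearMap.lTensor A f (a ⊗ₜ 1 * u) = a ⊗ₜ 1 * LinearMap.lTensor A f u := by
  induction u with
  | zero => simp
  | add u v hu hv => simp only [mul_add, map_add, hu, hv]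
  | tmul b h => simp

variable (CA CH DA) in
/-- The component in `A ⊗ Ω¹(H)` of the extended coaction. -/
def verComponent : ΩA →ₗ[k] A ⊗[k] ΩH := TensorProduct.map CA.proj0 (CH.projN 1) ∘ₗ DA

variable (CA CH ΛL DA) in
/-- The vertical projection on one-forms. -/
def verProj : ΩA →ₗ[k] A ⊗[k] ΩH :=
  TensorProduct.map CA.proj0 (piLam CH ΛL ∘ₗ CH.projN 1) ∘ₗ DA

lemma verProj_apply (x : ΩA) :
    verProj CA CH ΛL DA x = LinearMap.lTensor A (piLam CH ΛL) (verComponent CA CH DA x) := by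
  simp only [verProj, verComponent, LinearMap.coe_comp, Function.comp_apply, LinearMap.lTensor,
    TensorProduct.map_map, LinearMap.id_comp]

namespace IsCompleteExt

variable {S}

lemma verComponent_ι_mul_d_ι (hDA : IsCompleteExt S CA CH DA) (a b : A) :
    verComponent CA CH DA (CA.ι a * CA.d (CA.ι b)) =
      LinearMap.lTensor A CH.ι.toLinearMap (S.ρ a) *
        LinearMap.lTensor A (CH.d ∘ₗ CH.ι.toLinearMap) (S.ρ b) := by
  rw [verComponent, LinearMap.comp_apply, hDA.2.1, hDA.apply_ι, hDA.apply_d_ι]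
  generalize S.ρ a = u
  generalize S.ρ b = v
  induction v with
  | zero => simp
  | add v v' hv hv' =>
    simp only [tmul_add, map_add, mul_add] at hv hv' ⊢
    rw [← hv, ← hv']; abel
  | tmul b h =>
    induction u with
    | zero => simp
    | add u u' hu hu' =>
      simp only [add_tmul, map_add, add_mul, hu, hu']
    | tmul a g =>
      have hgh : CH.projN 1 (CH.ι g * CH.d (CH.ι h)) = CH.ι g * CH.d (CH.ι h) :=
        CH.projN_of_mem (CH.oneForm_mem (g ⊗ₜ h))
      simp [tmul_add, koszulMul_tmul_of_mem _ _ (CH.ι_mem g), CA.proj0_mul, CA.proj0_ι, hgh]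

lemma verProj_ι_mul_d_ι (hDA : IsCompleteExt S CA CH DA) (hΛ : IsLeftCovariantH CH ΛL)
    (a b : A) :
    verProj CA CH ΛL DA (CA.ι a * CA.d (CA.ι b)) =
      a ⊗ₜ 1 * LinearMap.lTensor A (cartan CH) (S.ρ b) := by
  have key (u v : A ⊗[k] H) :
      LinearMap.lTensor A (piLam CH ΛL) (LinearMap.lTensor A CH.ι.toLinearMap u *
        LinearMap.lTensor A (CH.d ∘ₗ CH.ι.toLinearMap) v) =
      TensorProduct.rid k A (LinearMap.lTensor A Coalgebra.counit u) ⊗ₜ 1 *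
        LinearMap.lTensor A (cartan CH) v := by
    induction v with
    | zero => simp
    | add v v' hv hv' => simp only [map_add, mul_add, hv, hv']
    | tmul b h =>
      induction u with
      | zero => simp
      | add u u' hu hu' => simp only [map_add, add_mul, hu, hu', add_tmul]
      | tmul a g => simp [hΛ.piLam_ι_mul, hΛ.piLam_d_ι, smul_tmul']
  rw [verProj_apply, hDA.verComponent_ι_mul_d_ι, key, S.lTensor_counit_ρ]
  simp

lemma verProj_oneForm (hDA : IsCompleteExt S CA CH DA) (hΛ : IsLeftCovariantH CH ΛL)
    (t : A ⊗[k] A) :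
    verProj CA CH ΛL DA (CA.oneForm t) = LinearMap.lTensor A (cartan CH) (chiAux S t) := by
  induction t with
  | zero => simp
  | add t t' h h' => simp only [map_add, h, h']
  | tmul a b =>
    rw [CA.oneForm_tmul, hDA.verProj_ι_mul_d_ι hΛ, chiAux_tmul, lTensor_tmul_one_mul]

/-- The extended coaction on a one-form is determined by its two components. -/
lemma apply_of_mem_one (hDA : IsCompleteExt S CA CH DA) {x : ΩA} (hx : x ∈ CA.grading 1) :
    DA x = LinearMap.lTensor ΩA CH.ι.toLinearMap (LinearMap.lTensor ΩA CH.proj0 (DA x)) +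
      LinearMap.rTensor ΩH CA.ι.toLinearMap (verComponent CA CH DA x) := by
  suffices tensorGrading CA.grading CH.grading 1 ≤ LinearMap.eqLocus LinearMap.id
      (LinearMap.lTensor ΩA CH.ι.toLinearMap ∘ₗ LinearMap.lTensor ΩA CH.proj0 +
        LinearMap.rTensor ΩH CA.ι.toLinearMap ∘ₗ TensorProduct.map CA.proj0 (CH.projN 1)) from
    this (hDA.2.2.2.2 1 x hx)
  refine iSup_le ?_
  rintro ⟨⟨i, j⟩, hij⟩ _ ⟨t, rfl⟩
  dsimp only at hij t ⊢
  induction t with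
  | zero => simp
  | add t t' h h' => simp only [map_add]; exact add_mem h h'
  | tmul y θ =>
    obtain ⟨y, hy⟩ := y
    obtain ⟨θ, hθ⟩ := θ
    rw [LinearMap.mem_eqLocus]
    obtain ⟨rfl, rfl⟩ | ⟨rfl, rfl⟩ : i = 1 ∧ j = 0 ∨ i = 0 ∧ j = 1 := by lia
    · obtain ⟨h, rfl⟩ := (CH.range_ι θ).1 hθ
      simp [CH.proj0_ι, CA.proj0_of_mem_ne one_ne_zero hy]
    · obtain ⟨a, rfl⟩ := (CA.range_ι y).1 hy
      simp [CA.proj0_ι, CH.proj0_of_mem_ne one_ne_zero hθ, CH.projN_of_mem hθ]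

lemma verComponent_eq_zero_of_verProj_eq_zero (hDA : IsCompleteExt S CA CH DA)
    (hΛ : IsLeftCovariantH CH ΛL) {x : ΩA} (hx : x ∈ CA.grading 1)
    (h : verProj CA CH ΛL DA x = 0) : verComponent CA CH DA x = 0 := by
  let R : A ⊗[k] ΩH →ₗ[k] A ⊗[k] ΩH := LinearMap.lTensor A (LinearMap.mul' k ΩH) ∘ₗ
    (TensorProduct.assoc k A ΩH ΩH).toLinearMap ∘ₗ
    TensorProduct.map (TensorProduct.map .id CH.ι.toLinearMap ∘ₗ S.ρ.toLinearMap) .id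
  have hmul (u v : A ⊗[k] H) (θ : ΩH) : LinearMap.lTensor A (LinearMap.mul' k ΩH)
      (TensorProduct.assoc k A ΩH ΩH (TensorProduct.map .id CH.ι.toLinearMap (u * v) ⊗ₜ θ)) =
      LinearMap.lTensor A CH.ι.toLinearMap u * LinearMap.lTensor A (LinearMap.mul' k ΩH)
        (TensorProduct.assoc k A ΩH ΩH (TensorProduct.map .id CH.ι.toLinearMap v ⊗ₜ θ)) := by
    induction v with
    | zero => simp
    | add v v' hv hv' => simp only [map_add, mul_add, add_tmul, hv, hv']
    | tmul b h =>
      induction u with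
      | zero => simp
      | add u u' hu hu' => simp only [map_add, add_mul, add_tmul, hu, hu']
      | tmul a g => simp [mul_assoc]
  have hRmul (a : A) (w : A ⊗[k] ΩH) :
      R (a ⊗ₜ 1 * w) = LinearMap.lTensor A CH.ι.toLinearMap (S.ρ a) * R w := by
    induction w with
    | zero => simp
    | add w w' h h' => simp only [map_add, mul_add, h, h']
    | tmul b θ => simpa [R] using hmul (S.ρ a) (S.ρ b) θ
  have hRcartan (b : A) : R (LinearMap.lTensor A (cartan CH) (S.ρ b)) =
      LinearMap.lTensor A (CH.d ∘ₗ CH.ι.toLinearMap) (S.ρ b) := by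
    simp only [R, LinearMap.comp_apply, LinearMap.lTensor, TensorProduct.map_map,
      LinearMap.comp_id, LinearMap.id_comp]
    rw [S.map_map_coassoc, LinearEquiv.coe_coe, LinearEquiv.apply_symm_apply,
      TensorProduct.map_map, mul_map_ι_cartan, LinearMap.id_comp]
  obtain ⟨t, rfl⟩ := CA.exists_oneForm hx
  suffices verComponent CA CH DA (CA.oneForm t) = R (verProj CA CH ΛL DA (CA.oneForm t)) by
    rw [this, h, map_zero]
  clear h hx
  induction t with
  | zero => simp
  | add t t' h h' => simp only [map_add, h, h']
  | tmul a b =>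
    rw [CA.oneForm_tmul, hDA.verComponent_ι_mul_d_ι, hDA.verProj_ι_mul_d_ι hΛ, hRmul, hRcartan]

lemma verProj_eq_zero_iff (hDA : IsCompleteExt S CA CH DA) (hΛ : IsLeftCovariantH CH ΛL)
    {x : ΩA} (hx : x ∈ CA.grading 1) :
    verProj CA CH ΛL DA x = 0 ↔ x ∈ horForms CH DA := by
  constructor
  · intro h
    have h0 := hDA.verComponent_eq_zero_of_verProj_eq_zero hΛ hx h
    have hx' := hDA.apply_of_mem_one hx
    rw [h0, map_zero, add_zero] at hx'
    exact ⟨_, hx'.symm⟩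
  · rintro ⟨t, ht⟩
    rw [verProj, LinearMap.comp_apply, ← ht]
    clear ht
    induction t with
    | zero => simp
    | add t t' h h' => simp only [map_add, h, h', add_zero]
    | tmul y h => simp [CH.projN_of_mem_ne zero_ne_one (CH.ι_mem h)]

lemma exists_verProj_eq (hDA : IsCompleteExt S CA CH DA) (hΛ : IsLeftCovariantH CH ΛL)
    (hχ : Function.Surjective (chiAux S)) {t : A ⊗[k] ΩH} (ht : t ∈ verSubN A CH ΛL 1) :
    ∃ x ∈ CA.grading 1, verProj CA CH ΛL DA x = t := by
  obtain ⟨s, rfl⟩ := ht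
  change _ ∈ (CA.grading 1).map (verProj CA CH ΛL DA)
  induction s with
  | zero => simp
  | add s s' h h' => simp only [map_add]; exact add_mem h h'
  | tmul a θ =>
    obtain ⟨θ, hθ, hθ1⟩ := θ
    obtain ⟨h, rfl⟩ := hΛ.exists_cartan hθ hθ1
    obtain ⟨z, hz⟩ := hχ (a ⊗ₜ h)
    exact ⟨CA.oneForm z, CA.oneForm_mem z, by simp [hDA.verProj_oneForm hΛ, hz]⟩

lemma verProj_ι_mul (hDA : IsCompleteExt S CA CH DA) (hΛ : IsLeftCovariantH CH ΛL)
    (a : A) {x : ΩA} (hx : x ∈ CA.grading 1) :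
    verProj CA CH ΛL DA (CA.ι a * x) =
      verMul S CH ((a ⊗ₜ (1 : ΩH)) ⊗ₜ verProj CA CH ΛL DA x) := by
  have hver (w : A ⊗[k] ΩH) : verMul S CH ((a ⊗ₜ (1 : ΩH)) ⊗ₜ w) = a ⊗ₜ 1 * w := by
    induction w with
    | zero => simp
    | add w w' h h' => simp only [tmul_add, map_add, mul_add, h, h']
    | tmul b θ =>
      have key (u : A ⊗[k] H) : TensorProduct.map (LinearMap.mul' k A)
          (LinearMap.mul' k ΩH ∘ₗ
            LinearMap.rTensor ΩH (TensorProduct.lift (adAct CH).flip) ∘ₗ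
            (TensorProduct.assoc k ΩH H ΩH).symm.toLinearMap)
          (TensorProduct.tensorTensorTensorComm k A ΩH A (H ⊗[k] ΩH)
            ((a ⊗ₜ 1) ⊗ₜ TensorProduct.assoc k A H ΩH (u ⊗ₜ θ))) =
          (a * TensorProduct.rid k A (LinearMap.lTensor A Coalgebra.counit u)) ⊗ₜ θ := by
        induction u with
        | zero => simp
        | add u u' hu hu' => simp only [map_add, add_tmul, tmul_add, mul_add, hu, hu']
        | tmul b h => simp [adAct_one, ← Algebra.smul_def, smul_tmul']
      refine (key (S.ρ b)).trans ?_
      rw [S.lTensor_counit_ρ]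
      simp
  rw [hver]
  obtain ⟨t, rfl⟩ := CA.exists_oneForm hx
  clear hx
  induction t with
  | zero => simp
  | add t t' h h' => simp only [map_add, mul_add, h, h']
  | tmul b c =>
    rw [CA.oneForm_tmul, ← mul_assoc, ← map_mul, hDA.verProj_ι_mul_d_ι hΛ,
      hDA.verProj_ι_mul_d_ι hΛ, ← mul_assoc]
    simp

lemma verProj_mul_ι (hDA : IsCompleteExt S CA CH DA) (hΛ : IsLeftCovariantH CH ΛL)
    (c : A) {x : ΩA} (hx : x ∈ CA.grading 1) :
    verProj CA CH ΛL DA (x * CA.ι c) =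
      verMul S CH (verProj CA CH ΛL DA x ⊗ₜ (c ⊗ₜ (1 : ΩH))) := by
  have hver (w : A ⊗[k] ΩH) : verMul S CH (w ⊗ₜ (c ⊗ₜ 1)) =
      TensorProduct.map (LinearMap.mul' k A) (TensorProduct.lift (adAct CH).flip)
        (TensorProduct.tensorTensorTensorComm k A ΩH A H (w ⊗ₜ S.ρ c)) := by
    simp only [verMul, LinearMap.comp_apply, LinearMap.lTensor_tmul, LinearMap.rTensor_tmul,
      LinearEquiv.coe_coe, AlgHom.toLinearMap_apply]
    generalize S.ρ c = u
    induction u with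
    | zero => simp
    | add u u' hu hu' => simp only [map_add, add_tmul, tmul_add, hu, hu']
    | tmul d h =>
      induction w with
      | zero => simp
      | add w w' h h' => simp only [map_add, add_tmul, h, h']
      | tmul a θ => simp
  have key (u v : A ⊗[k] H) : LinearMap.lTensor A (cartan CH) (u * v) =
      TensorProduct.map (LinearMap.mul' k A) (TensorProduct.lift (adAct CH).flip)
        (TensorProduct.tensorTensorTensorComm k A ΩH A H
          (LinearMap.lTensor A (cartan CH) u ⊗ₜ v)) +
      TensorProduct.rid k A (LinearMap.lTensor A Coalgebra.counit u) ⊗ₜ 1 *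
        LinearMap.lTensor A (cartan CH) v := by
    induction v with
    | zero => simp
    | add v v' hv hv' => simp only [map_add, mul_add, tmul_add, hv, hv']; abel
    | tmul b h =>
      induction u with
      | zero => simp
      | add u u' hu hu' => simp only [map_add, add_mul, add_tmul, hu, hu']; abel
      | tmul a g => simp [cartan_mul, tmul_add, smul_tmul']
  obtain ⟨t, rfl⟩ := CA.exists_oneForm hx
  rw [hver, hDA.verProj_oneForm hΛ, ← sub_eq_iff_eq_add.2 (key _ _),
    S.rid_lTensor_counit_chiAux]
  clear hx
  induction t with
  | zero => simp
  | add t t' h h' => simp only [map_add, add_mul, add_tmul, h, h']; abel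
  | tmul a b =>
    rw [CA.oneForm_tmul_mul_ι, hDA.verProj_oneForm hΛ, map_sub, map_sub, chiAux_tmul, chiAux_tmul,
      chiAux_tmul, map_mul S.ρ, mul_assoc, lTensor_tmul_one_mul (a := a * b)]
    simp

end IsCompleteExt
end VerticalProjection

section CovariantBimodule

variable {H : Type*} [Ring H] [HopfAlgebra k H]
variable {A : Type*} [Ring A] [Algebra k A]
variable {ΩA : Type*} [Ring ΩA] [Algebra k ΩA]
variable {ΩH : Type*} [Ring ΩH] [Algebra k ΩH]
variable {S : ComodAlg k H A} {CA : DiffCalc k A ΩA} {CH : DiffCalc k H ΩH}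
variable {ΛL : ΩH →ₗ[k] H ⊗[k] ΩH}
variable {DA : ΩA →ₗ[k] ΩA ⊗[k] ΩH} {DH : ΩH →ₗ[k] ΩH ⊗[k] ΩH}

namespace IsCompleteExt

lemma rTensor_verProj (hDA : IsCompleteExt S CA CH DA) (hΛ : IsLeftCovariantH CH ΛL)
    (hDH : IsCompleteExtH CH DH) {x : ΩA} (hx : x ∈ CA.grading 1) :
    LinearMap.rTensor H (verProj CA CH ΛL DA) ((LinearMap.lTensor ΩA CH.proj0 ∘ₗ DA) x) =
      (LinearMap.lTensor (A ⊗[k] ΩH) (LinearMap.mul' k H) ∘ₗ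
        (TensorProduct.tensorTensorTensorComm k A H ΩH H).toLinearMap ∘ₗ
        TensorProduct.map S.ρ.toLinearMap (LinearMap.lTensor ΩH CH.proj0 ∘ₗ DH))
        (verProj CA CH ΛL DA x) := by
  set P := LinearMap.lTensor ΩH CH.proj0 ∘ₗ DH with hP
  let E : A ⊗[k] H →ₗ[k] (A ⊗[k] ΩH) ⊗[k] H :=
    LinearMap.rTensor H ((TensorProduct.mk k A ΩH).flip 1)
  set Y := LinearMap.lTensor (A ⊗[k] ΩH) (LinearMap.mul' k H) ∘ₗ
    (TensorProduct.tensorTensorTensorComm k A H ΩH H).toLinearMap with hY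
  have hYmul (u v : A ⊗[k] H) (q : ΩH ⊗[k] H) : Y ((u * v) ⊗ₜ q) = E u * Y (v ⊗ₜ q) := by
    induction u with
    | zero => simp
    | add u u' hu hu' => simp only [add_mul, add_tmul, map_add, hu, hu']
    | tmul a g =>
      induction v with
      | zero => simp
      | add v v' hv hv' => simp only [mul_add, add_tmul, map_add, hv, hv']
      | tmul b h =>
        induction q with
        | zero => simp
        | add q q' hq hq' => simp only [mul_add, tmul_add, map_add, hq, hq']
        | tmul θ l => simp [hY, E, mul_assoc]
  have hZmul (a : A) (w : A ⊗[k] ΩH) : Y (TensorProduct.map S.ρ.toLinearMap P (a ⊗ₜ 1 * w)) =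
      E (S.ρ a) * Y (TensorProduct.map S.ρ.toLinearMap P w) := by
    induction w with
    | zero => simp
    | add w w' h h' => simp only [mul_add, map_add, h, h']
    | tmul b θ => simpa using hYmul (S.ρ a) (S.ρ b) (P θ)
  have hYassoc (f : H →ₗ[k] ΩH ⊗[k] H) (u : A ⊗[k] (H ⊗[k] H)) :
      Y ((TensorProduct.assoc k A H (ΩH ⊗[k] H)).symm
        (TensorProduct.map .id (TensorProduct.map .id f) u)) =
      (TensorProduct.assoc k A ΩH H).symm (LinearMap.lTensor A (LinearMap.mul' k (ΩH ⊗[k] H))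
        (TensorProduct.map .id
          (TensorProduct.map Algebra.TensorProduct.includeRight.toLinearMap f) u)) := by
    induction u with
    | zero => simp
    | add u u' h h' => simp only [map_add, h, h']
    | tmul a w =>
      induction w with
      | zero => simp
      | add w w' h h' => simp only [tmul_add, map_add, h, h']
      | tmul g h =>
        simp only [TensorProduct.map_tmul, LinearMap.id_apply]
        generalize f h = q
        induction q with
        | zero => simp
        | add q q' h h' => simp only [tmul_add, map_add, h, h']
        | tmul θ l => simp [hY]
  have hZcartan (b : A) : Y (TensorProduct.map S.ρ.toLinearMap P
      (LinearMap.lTensor A (cartan CH) (S.ρ b))) =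
      TensorProduct.map (LinearMap.lTensor A (cartan CH) ∘ₗ S.ρ.toLinearMap) .id (S.ρ b) := by
    have h1 := S.map_map_coassoc .id .id (P ∘ₗ cartan CH) b
    have h2 := hYassoc (P ∘ₗ cartan CH) (TensorProduct.map .id Coalgebra.comul (S.ρ b))
    rw [TensorProduct.map_map, TensorProduct.map_map, LinearMap.id_comp, ← h1,
      TensorProduct.map_id, LinearMap.id_comp, LinearMap.lTensor, TensorProduct.map_map,
      mul_includeRight_map_cartan hDH, LinearMap.id_comp] at h2
    rw [LinearMap.lTensor, TensorProduct.map_map, LinearMap.comp_id, h2]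
    exact (S.map_map_coassoc _ _ _ b).symm
  have hL (a : A) (u v : A ⊗[k] H) :
      LinearMap.rTensor H (verProj CA CH ΛL DA) (LinearMap.rTensor H CA.ι.toLinearMap u *
        LinearMap.rTensor H (CA.d ∘ₗ CA.ι.toLinearMap) v) =
      E u * TensorProduct.map (LinearMap.lTensor A (cartan CH) ∘ₗ S.ρ.toLinearMap) .id v := by
    induction u with
    | zero => simp
    | add u u' hu hu' => simp only [add_mul, map_add, hu, hu']
    | tmul a g =>
      induction v with
      | zero => simp
      | add v v' hv hv' => simp only [mul_add, map_add, hv, hv']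
      | tmul b h => simp [E, hDA.verProj_ι_mul_d_ι hΛ]
  obtain ⟨t, rfl⟩ := CA.exists_oneForm hx
  clear hx
  induction t with
  | zero => simp
  | add t t' h h' => simp only [map_add, h, h']
  | tmul a b =>
    rw [CA.oneForm_tmul, LinearMap.comp_apply, hDA.lTensor_proj0_mul, hDA.lTensor_proj0_ι,
      hDA.lTensor_proj0_d_ι, hL a, hDA.verProj_ι_mul_d_ι hΛ, ← hZcartan, ← hZmul]
    rfl

lemma ι_mem_horForms (hDA : IsCompleteExt S CA CH DA) (a : A) : CA.ι a ∈ horForms CH DA :=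
  ⟨LinearMap.rTensor H CA.ι.toLinearMap (S.ρ a), by
    rw [hDA.apply_ι, LinearMap.lTensor, LinearMap.rTensor, TensorProduct.map_map,
      LinearMap.id_comp, LinearMap.comp_id]⟩

lemma mul_mem_horForms (hDA : IsCompleteExt S CA CH DA) {x y : ΩA} (hx : x ∈ horForms CH DA)
    (hy : y ∈ horForms CH DA) : x * y ∈ horForms CH DA := by
  obtain ⟨s, hs⟩ := hx
  obtain ⟨t, ht⟩ := hy
  refine ⟨s * t, ?_⟩
  rw [hDA.2.1, ← hs, ← ht]
  clear hs ht
  induction s with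
  | zero => simp
  | add s s' h h' => simp only [add_mul, add_tmul, map_add, h, h']
  | tmul m g =>
    induction t with
    | zero => simp
    | add t t' h h' => simp only [mul_add, tmul_add, map_add, h, h']
    | tmul n h => simp [koszulMul_tmul_of_mem _ _ (CH.ι_mem g)]

lemma lTensor_proj0_mem_horForms [Module.Flat k H] (hDA : IsCompleteExt S CA CH DA)
    (hDH : IsCompleteExtH CH DH) {x : ΩA} (hx : x ∈ horForms CH DA) :
    LinearMap.lTensor ΩA CH.proj0 (DA x) ∈
      LinearMap.range (LinearMap.rTensor H (horForms CH DA).subtype) := by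
  let q := (LinearMap.range (LinearMap.lTensor ΩA CH.ι.toLinearMap)).mkQ
  have hq (y : ΩA) (h : H) : q (y ⊗ₜ CH.ι h) = 0 :=
    (Submodule.Quotient.mk_eq_zero _).2 ⟨y ⊗ₜ h, rfl⟩
  have hexact : Function.Exact (horForms CH DA).subtype (q ∘ₗ DA) := by
    rw [LinearMap.exact_iff, LinearMap.ker_comp, Submodule.ker_mkQ, Submodule.range_subtype]
    rfl
  refine (Module.Flat.rTensor_exact H hexact _).1 ?_
  rw [LinearMap.rTensor_comp, LinearMap.comp_apply, hDA.rTensor_lTensor_proj0 hDH]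
  obtain ⟨t, ht⟩ := hx
  rw [← ht]
  clear ht
  induction t with
  | zero => simp
  | add t t' h h' => simp only [map_add, h, h', add_zero]
  | tmul y h =>
    have hι := hDH.lTensor_proj0_ι h
    simp only [LinearMap.lTensor_tmul, LinearMap.comp_apply, AlgHom.toLinearMap_apply, hι]
    generalize (comulComod k H).ρ h = u
    induction u with
    | zero => simp
    | add u u' h h' => simp only [map_add, tmul_add, h, h', add_zero]
    | tmul g l => simp [hq]

end IsCompleteExt
end CovariantBimodule

end NCG
namespace NCG

/-- For any complete calculus on a quantum principal bundle
the Atiyah sequence `0 → hor¹ → Ω¹(A) → ver¹ → 0` is exact in the category of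
right `H`-covariant `A`-bimodules: on degree-one forms the vertical
projection `π_v` is surjective onto `ver¹ = A ⊗ Λ¹` with kernel exactly
`hor¹`, it is an `A`-bimodule and right `H`-comodule map, and `hor¹` is a
subobject. -/
theorem atiyah_sequence_exact
    {k : Type*} [Field k] {H : Type*} [Ring H] [HopfAlgebra k H]
    (hS : Function.Bijective (HopfAlgebra.antipode (R := k) (A := H)))
    {A : Type*} [Ring A] [Algebra k A] (S : ComodAlg k H A) (hQPB : S.IsQPB)
    {ΩH : Type*} [Ring ΩH] [Algebra k ΩH] (CH : DiffCalc k H ΩH)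
    (ΔR : ΩH →ₗ[k] ΩH ⊗[k] H) (ΛL : ΩH →ₗ[k] H ⊗[k] ΩH)
    (hbicov : IsBicovariantH CH ΔR ΛL) (hmax : IsMaxProl (k := k) CH)
    (DH : ΩH →ₗ[k] ΩH ⊗[k] ΩH) (hDH : IsCompleteExtH CH DH)
    {ΩA : Type*} [Ring ΩA] [Algebra k ΩA] (CA : DiffCalc k A ΩA)
    (DA : ΩA →ₗ[k] ΩA ⊗[k] ΩH) (hDA : IsCompleteExt S CA CH DA)
    (πv1 : ΩA →ₗ[k] A ⊗[k] ΩH)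
    (hπv1 : πv1 =
      TensorProduct.map CA.proj0 (piLam CH ΛL ∘ₗ CH.toDGA.projN 1) ∘ₗ DA) :
    -- exactness: `ker (π_v|₁) = hor¹` ...
    (∀ x ∈ CA.grading 1, (πv1 x = 0 ↔ x ∈ horForms CH DA)) ∧
    -- ... and `π_v|₁` surjects onto `ver¹ = A ⊗ Λ¹`
    (∀ t ∈ verSubN A CH ΛL 1, ∃ x ∈ CA.grading 1, πv1 x = t) ∧
    -- `π_v` is a morphism of `A`-bimodules ...
    (∀ a : A, ∀ x ∈ CA.grading 1,
      πv1 (CA.ι a * x) = verMul S CH ((a ⊗ₜ[k] (1 : ΩH)) ⊗ₜ[k] πv1 x)) ∧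
    (∀ a : A, ∀ x ∈ CA.grading 1,
      πv1 (x * CA.ι a) = verMul S CH (πv1 x ⊗ₜ[k] (a ⊗ₜ[k] (1 : ΩH)))) ∧
    -- ... and of right `H`-comodules
    (∀ x ∈ CA.grading 1,
      LinearMap.rTensor H πv1 ((LinearMap.lTensor ΩA CH.proj0 ∘ₗ DA) x) =
        (LinearMap.lTensor (A ⊗[k] ΩH) (LinearMap.mul' k H) ∘ₗ
          (TensorProduct.tensorTensorTensorComm k A H ΩH H).toLinearMap ∘ₗ
          TensorProduct.map S.ρ.toLinearMap
            (LinearMap.lTensor ΩH CH.proj0 ∘ₗ DH)) (πv1 x)) ∧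
    -- `hor¹` is a subobject in the category of covariant bimodules
    (∀ a : A, ∀ x ∈ horForms CH DA,
      CA.ι a * x ∈ horForms CH DA ∧ x * CA.ι a ∈ horForms CH DA) ∧
    (∀ x ∈ horForms CH DA,
      (LinearMap.lTensor ΩA CH.proj0 ∘ₗ DA) x ∈
        LinearMap.range (LinearMap.rTensor H (horForms CH DA).subtype)) := by
  have hΛ := hbicov.2.1
  obtain rfl : πv1 = verProj CA CH ΛL DA := hπv1
  exact ⟨fun x hx => hDA.verProj_eq_zero_iff hΛ hx,
    fun t ht => hDA.exists_verProj_eq hΛ hQPB.1.1 ht,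
    fun a x hx => hDA.verProj_ι_mul hΛ a hx,
    fun a x hx => hDA.verProj_mul_ι hΛ a hx,
    fun x hx => hDA.rTensor_verProj hΛ hDH hx,
    fun a x hx => ⟨hDA.mul_mem_horForms (hDA.ι_mem_horForms a) hx,
      hDA.mul_mem_horForms hx (hDA.ι_mem_horForms a)⟩,
    fun x hx => hDA.lTensor_proj0_mem_horForms hDH hx⟩

end NCG
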